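/- Theorem 3, part 1 (consistent origination dating, coefficient statistic). Under the bubble model with Assumptions A1 and A2 and the initial-value condition, let (cv_n) be positive thresholds satisfying 1/cv_n + cv_n/n^{1−α} → 0 as n → ∞ (so cv_n → ∞ and cv_n = o(n^{1−α})). Then the estimated origination fraction r̂_e := inf{ s ∈ [r_0,1] : SV-ADF^δ_{⌊ns⌋} > cv_n } (with inf ∅ := 1) converges in probability to the true origination fraction r_e as n → ∞. -/

import Mathlib

open MeasureTheory ProbabilityTheory Filter

/-- The average innovation variance `m_{n,k} = k⁻¹ Σ_{t=1}^k E[σ_t²]`. -/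
noncomputable def avgVar {Ω : Type*} [MeasurableSpace Ω] (P : ℕ → Measure Ω)
    (σ : ℕ → ℕ → Ω → ℝ) (n k : ℕ) : ℝ :=
  (∑ t ∈ Finset.Icc 1 k, ∫ ω, (σ n t ω) ^ 2 ∂(P n)) / k

/-- Recursive sample mean `X̄_τ = τ⁻¹ Σ_{k=1}^τ X_{k-1}`. -/
noncomputable def xbar {Ω : Type*} (X : ℕ → Ω → ℝ) (τ : ℕ) (ω : Ω) : ℝ :=
  (∑ k ∈ Finset.Icc 1 τ, X (k - 1) ω) / τ

/-- Demeaned observation `X̃_j = X_j - X̄_τ`. -/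
noncomputable def xtil {Ω : Type*} (X : ℕ → Ω → ℝ) (τ j : ℕ) (ω : Ω) : ℝ :=
  X j ω - xbar X τ ω

/-- OLS slope `δ̂(τ) = (Σ_{j=1}^τ X̃_{j-1} X_j)/(Σ_{j=1}^τ X̃_{j-1}²)`. -/
noncomputable def deltaHat {Ω : Type*} (X : ℕ → Ω → ℝ) (τ : ℕ) (ω : Ω) : ℝ :=
  (∑ j ∈ Finset.Icc 1 τ, xtil X τ (j - 1) ω * X j ω) /
    ∑ j ∈ Finset.Icc 1 τ, (xtil X τ (j - 1) ω) ^ 2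

/-- Coefficient-based recursive statistic `SV-ADF^δ_τ = τ (δ̂(τ) - 1)`. -/
noncomputable def svadfDelta {Ω : Type*} (X : ℕ → Ω → ℝ) (τ : ℕ) (ω : Ω) : ℝ :=
  (τ : ℝ) * (deltaHat X τ ω - 1)

/-- Estimated origination fraction:
`r̂_e = inf { s ∈ [r₀, 1] : stat_{⌊ns⌋} > cv }`, with `inf ∅ := 1` (implemented by
adjoining `{1}` to the set, which does not change the infimum when the set of
crossing times in `[r₀,1]` is nonempty). -/
noncomputable def rHatE {Ω : Type*} (stat : ℕ → Ω → ℝ) (n : ℕ) (r0 cv : ℝ)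
    (ω : Ω) : ℝ :=
  sInf ({s : ℝ | s ∈ Set.Icc r0 1 ∧ cv < stat ⌊(n : ℝ) * s⌋₊ ω} ∪ {1})


/-- Single-space martingale-difference structure, zero-indexed. -/
structure MD {Ω : Type*} [MeasurableSpace Ω] (P : Measure Ω) (F : ℕ → MeasurableSpace Ω)
    (s e : ℕ → Ω → ℝ) : Prop where
  mono : Monotone F
  le : ∀ t, F t ≤ ‹MeasurableSpace Ω›
  smeas : ∀ t, Measurable[F t] (s t)
  umeas : ∀ t, Measurable[F (t + 1)] (fun ω => s t ω * e t ω)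
  emeas : ∀ t, Measurable (e t)
  sq : ∀ t, Integrable (fun ω => (s t ω) ^ 2) P
  gi : ∀ t, (∀ ω, s t ω = 0) ∨ (Measure.map (e t) P = gaussianReal 0 1 ∧
    Indep (MeasurableSpace.comap (e t) inferInstance) (F t) P)

/-- partial sums -/
noncomputable def pS {Ω : Type*} (s e : ℕ → Ω → ℝ) (k : ℕ) (ω : Ω) : ℝ :=
  ∑ t ∈ Finset.range k, s t ω * e t ω

section MDsec
variable {Ω : Type*} [mΩ : MeasurableSpace Ω] {P : Measure Ω} {F : ℕ → MeasurableSpace Ω}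
  {s e : ℕ → Ω → ℝ}

theorem MD.smeas' (h : MD P F s e) (t : ℕ) : Measurable (s t) := (h.smeas t).mono (h.le t) le_rfl

theorem MD.weight (h : MD P F s e) (w : ℕ → ℝ) : MD P F (fun t ω => w t * s t ω) e where
  mono := h.mono
  le := h.le
  smeas t := (h.smeas t).const_mul (w t)
  umeas t := by
    have := (h.umeas t).const_mul (w t)
    simpa only [mul_assoc] using this
  emeas := h.emeas
  sq t := by
    have := (h.sq t).const_mul ((w t) ^ 2)
    simpa only [mul_pow] using this
  gi t := by
    rcases h.gi t with h0 | h0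
    · left; intro ω; simp [h0 ω]
    · right; exact h0

theorem MD.pS_meas (h : MD P F s e) (k : ℕ) : Measurable[F k] (pS s e k) := by
  unfold pS
  refine Finset.measurable_sum _ fun t ht => ?_
  exact (h.umeas t).mono (h.mono (by have := Finset.mem_range.1 ht; omega)) le_rfl

theorem MD.pS_meas' (h : MD P F s e) (k : ℕ) : Measurable (pS s e k) :=
  (h.pS_meas k).mono (h.le k) le_rfl

theorem gauss_int {x : Ω → ℝ} (hx : Measurable x) (hg : Measure.map x P = gaussianReal 0 1) :
    Integrable x P ∧ ∫ ω, x ω ∂P = 0 ∧ Integrable (fun ω => x ω ^ 2) P ∧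
      ∫ ω, x ω ^ 2 ∂P = 1 := by
  have h1 : Integrable (fun y : ℝ => y) (gaussianReal 0 1) := by
    have := (memLp_id_gaussianReal (μ := 0) (v := 1) 1)
    exact memLp_one_iff_integrable.1 this
  have h2 : Integrable (fun y : ℝ => y ^ 2) (gaussianReal 0 1) := by
    have := (memLp_id_gaussianReal (μ := 0) (v := 1) 2)
    exact this.integrable_sq
  refine ⟨?_, ?_, ?_, ?_⟩
  · rw [← hg] at h1
    exact h1.comp_measurable hx
  · have := integral_map (μ := P) hx.aemeasurable (f := fun y : ℝ => y) (by fun_prop)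
    rw [← this, hg]
    simp
  · rw [← hg] at h2
    exact h2.comp_measurable hx
  · have := integral_map (μ := P) hx.aemeasurable (f := fun y : ℝ => y ^ 2) (by fun_prop)
    rw [← this, hg]
    have hv := variance_fun_id_gaussianReal (μ := 0) (v := 1)
    rw [variance_of_integral_eq_zero (by fun_prop) (by simp)] at hv
    simpa using hv

theorem MD.indepFun (_h : MD P F s e) (t : ℕ) {β : Type*} [MeasurableSpace β] {Y : Ω → β}
    (hY : Measurable[F t] Y)
    (hi : Indep (MeasurableSpace.comap (e t) inferInstance) (F t) P) : IndepFun Y (e t) P := by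
  rw [IndepFun_iff_Indep]
  exact (indep_of_indep_of_le_right hi hY.comap_le).symm

theorem MD.cross (h : MD P F s e) (t : ℕ) {Y : Ω → ℝ} (hY : Measurable[F t] Y)
    (hYi : Integrable (fun ω => Y ω * s t ω) P) :
    Integrable (fun ω => Y ω * (s t ω * e t ω)) P ∧ ∫ ω, Y ω * (s t ω * e t ω) ∂P = 0 := by
  rcases h.gi t with h0 | ⟨hg, hi⟩
  · simp [h0]
  · obtain ⟨g1, g2, -, -⟩ := gauss_int (h.emeas t) hg
    have hI := h.indepFun t (hY.mul (h.smeas t)) hi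
    have e1 : (fun ω => Y ω * (s t ω * e t ω)) = fun ω => (Y * s t) ω * e t ω := by
      funext ω; simp [mul_assoc]
    rw [e1]
    refine ⟨hI.integrable_mul hYi g1, ?_⟩
    rw [hI.integral_fun_mul_eq_mul_integral hYi.aestronglyMeasurable g1.aestronglyMeasurable, g2,
      mul_zero]

theorem MD.usq (h : MD P F s e) (t : ℕ) :
    Integrable (fun ω => (s t ω * e t ω) ^ 2) P ∧
      ∫ ω, (s t ω * e t ω) ^ 2 ∂P = ∫ ω, (s t ω) ^ 2 ∂P := by
  rcases h.gi t with h0 | ⟨hg, hi⟩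
  · simp [h0]
  · obtain ⟨-, -, g1, g2⟩ := gauss_int (h.emeas t) hg
    have hI : IndepFun (fun ω => s t ω ^ 2) (fun ω => e t ω ^ 2) P :=
      (h.indepFun t (h.smeas t) hi).comp (φ := fun x : ℝ => x ^ 2) (ψ := fun x : ℝ => x ^ 2)
        (by fun_prop) (by fun_prop)
    simp only [mul_pow]
    refine ⟨hI.integrable_mul (h.sq t) g1, ?_⟩
    rw [hI.integral_fun_mul_eq_mul_integral (h.sq t).aestronglyMeasurable g1.aestronglyMeasurable,
      g2, mul_one]

theorem MD.uL2 (h : MD P F s e) (t : ℕ) : MemLp (fun ω => s t ω * e t ω) 2 P :=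
  (memLp_two_iff_integrable_sq (((h.umeas t).mono (h.le _) le_rfl).aestronglyMeasurable)).2
    (h.usq t).1

theorem MD.sL2 (h : MD P F s e) (t : ℕ) : MemLp (s t) 2 P :=
  (memLp_two_iff_integrable_sq ((h.smeas' t).aestronglyMeasurable)).2 (h.sq t)

theorem MD.pSL2 (h : MD P F s e) (k : ℕ) : MemLp (pS s e k) 2 P := by
  unfold pS
  exact memLp_finsetSum _ fun t _ => h.uL2 t

theorem MD.pSsq (h : MD P F s e) (k : ℕ) : Integrable (fun ω => pS s e k ω ^ 2) P :=
  (h.pSL2 k).integrable_sq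

theorem pS_succ_sq (k : ℕ) (ω : Ω) : pS s e (k + 1) ω ^ 2 =
    pS s e k ω ^ 2 + 2 * (pS s e k ω * (s k ω * e k ω)) + (s k ω * e k ω) ^ 2 := by
  unfold pS
  rw [Finset.sum_range_succ]; ring

theorem MD.second (h : MD P F s e) (k : ℕ) :
    ∫ ω, pS s e k ω ^ 2 ∂P = ∑ t ∈ Finset.range k, ∫ ω, (s t ω) ^ 2 ∂P := by
  induction k with
  | zero => simp [pS]
  | succ k ih =>
    have hc := h.cross k (h.pS_meas k) ((h.pSL2 k).integrable_mul (h.sL2 k))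
    simp only [pS_succ_sq]
    have hi : Integrable (fun ω => pS s e k ω ^ 2 + 2 * (pS s e k ω * (s k ω * e k ω))) P :=
      (h.pSsq k).add (hc.1.const_mul 2)
    rw [integral_add hi (h.usq k).1,
      integral_add (h.pSsq k) (hc.1.const_mul 2), integral_const_mul, hc.2, ih, (h.usq k).2,
      Finset.sum_range_succ]
    ring

theorem MD.subm [IsProbabilityMeasure P] (h : MD P F s e) :
    Submartingale (fun k ω => pS s e k ω ^ 2) ⟨F, h.mono, h.le⟩ P := by
  refine submartingale_of_setIntegral_le_succ ?_ h.pSsq ?_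
  · intro k
    exact Measurable.stronglyMeasurable (mα := F k) ((h.pS_meas k).pow_const 2)
  · intro k A hA
    have hA' : MeasurableSet A := h.le k _ hA
    have hm : Measurable[F k] (A.indicator (pS s e k)) := (h.pS_meas k).indicator hA
    have hi : Integrable (fun ω => A.indicator (pS s e k) ω * s k ω) P := by
      have := ((h.pSL2 k).integrable_mul (h.sL2 k)).indicator hA'
      refine this.congr (Eventually.of_forall fun ω => ?_)
      by_cases hω : ω ∈ A <;> simp [hω]
    have hc' := h.cross k (h.pS_meas k) ((h.pSL2 k).integrable_mul (h.sL2 k))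
    have hc := (h.cross k hm hi).2
    have hc2 : ∫ ω in A, pS s e k ω * (s k ω * e k ω) ∂P = 0 := by
      rw [← hc, ← integral_indicator hA']
      refine integral_congr_ae (Eventually.of_forall fun ω => ?_)
      by_cases hω : ω ∈ A <;> simp [hω]
    simp only [pS_succ_sq]
    have hi2 : Integrable (fun ω => pS s e k ω ^ 2 + 2 * (pS s e k ω * (s k ω * e k ω))) P :=
      (h.pSsq k).add (hc'.1.const_mul 2)
    rw [integral_add hi2.integrableOn (h.usq k).1.integrableOn,
      integral_add (h.pSsq k).integrableOn (hc'.1.const_mul 2).integrableOn, integral_const_mul,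
      hc2]
    have : 0 ≤ ∫ ω in A, (s k ω * e k ω) ^ 2 ∂P := integral_nonneg fun ω => sq_nonneg _
    linarith

theorem MD.doob [IsProbabilityMeasure P] (h : MD P F s e) (n : ℕ) {lam : ℝ} (hl : 0 < lam) :
    P {ω | ∃ k ≤ n, lam ≤ |pS s e k ω|} ≤
      ENNReal.ofReal ((∑ t ∈ Finset.range n, ∫ ω, (s t ω) ^ 2 ∂P) / lam ^ 2) := by
  have hcoe : (((lam ^ 2).toNNReal : NNReal) : ℝ) = lam ^ 2 := Real.coe_toNNReal _ (by positivity)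
  have hm := maximal_ineq h.subm (fun k ω => sq_nonneg _) (ε := (lam ^ 2).toNNReal) n
  rw [hcoe] at hm
  have hsub : {ω | ∃ k ≤ n, lam ≤ |pS s e k ω|} ⊆ {ω | lam ^ 2 ≤
      (Finset.range (n + 1)).sup' Finset.nonempty_range_add_one fun k => pS s e k ω ^ 2} := by
    rintro ω ⟨k, hk, hle⟩
    simp only [Set.mem_ofPred_eq]
    refine le_trans ?_ (Finset.le_sup' (fun k => pS s e k ω ^ 2)
      (Finset.mem_range.2 (by omega : k < n + 1)))
    rw [← sq_abs (pS s e k ω)]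
    gcongr
  have h2 := hm.trans (ENNReal.ofReal_le_ofReal (setIntegral_le_integral (h.pSsq n)
    (Eventually.of_forall fun ω => sq_nonneg _)))
  rw [h.second n] at h2
  rw [ENNReal.ofReal_div_of_pos (by positivity),
    ENNReal.le_div_iff_mul_le (by left; positivity) (by left; simp), mul_comm]
  refine le_trans ?_ h2
  exact mul_le_mul' le_rfl (measure_mono hsub)

end MDsec


section MDchar
variable {Ω : Type*} [mΩ : MeasurableSpace Ω] {P : Measure Ω} {F : ℕ → MeasurableSpace Ω}
  {s e : ℕ → Ω → ℝ}

/-- partial quadratic variation -/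
noncomputable def pV {Ω : Type*} (s : ℕ → Ω → ℝ) (k : ℕ) (ω : Ω) : ℝ :=
  ∑ t ∈ Finset.range k, s t ω ^ 2

theorem MD.pV_meas (h : MD P F s e) (k j : ℕ) (hkj : k ≤ j + 1) : Measurable[F j] (pV s k) := by
  unfold pV
  refine Finset.measurable_sum _ fun t ht => ?_
  exact ((h.smeas t).mono (h.mono (by have := Finset.mem_range.1 ht; omega)) le_rfl).pow_const 2

theorem MD.pV_meas' (h : MD P F s e) (k : ℕ) : Measurable (pV s k) :=
  (h.pV_meas k k (by omega)).mono (h.le k) le_rfl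

/-- truncated volatility -/
noncomputable def trn {Ω : Type*} (s : ℕ → Ω → ℝ) (q : ℝ) (t : ℕ) (ω : Ω) : ℝ :=
  if pV s (t + 1) ω ≤ q then s t ω else 0

theorem MD.trunc (h : MD P F s e) (q : ℝ) : MD P F (trn s q) e := by
  have hset : ∀ t, MeasurableSet[F t] {ω | pV s (t + 1) ω ≤ q} := fun t =>
    (h.pV_meas (t + 1) t le_rfl) measurableSet_Iic
  refine ⟨h.mono, h.le, fun t => ?_, fun t => ?_, h.emeas, fun t => ?_, fun t => ?_⟩
  · exact Measurable.ite (hset t) (h.smeas t) measurable_const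
  · have : (fun ω => trn s q t ω * e t ω) =
        fun ω => if pV s (t + 1) ω ≤ q then s t ω * e t ω else 0 := by
      funext ω; unfold trn; split_ifs <;> simp
    rw [this]
    exact Measurable.ite (h.mono (Nat.le_succ t) _ (hset t)) (h.umeas t) measurable_const
  · refine ((h.sq t).indicator (h.le t _ (hset t))).congr (Eventually.of_forall fun ω => ?_)
    by_cases hω : pV s (t + 1) ω ≤ q <;> simp [trn, hω, Set.indicator]
  · rcases h.gi t with h0 | h0
    · left; intro ω; simp [trn, h0 ω]
    · right; exact h0

theorem pV_nonneg (k : ℕ) (ω : Ω) : 0 ≤ pV s k ω := Finset.sum_nonneg fun _ _ => sq_nonneg _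

theorem pV_trn_le {q : ℝ} (hq : 0 ≤ q) (k : ℕ) (ω : Ω) : pV (trn s q) k ω ≤ q := by
  induction k with
  | zero => simpa [pV] using hq
  | succ k ih =>
    by_cases hk : pV s (k + 1) ω ≤ q
    · refine le_trans ?_ hk
      unfold pV
      refine Finset.sum_le_sum fun t _ => ?_
      unfold trn
      split_ifs
      · exact le_rfl
      · simpa using sq_nonneg (s t ω)
    · have : trn s q k ω = 0 := by simp [trn, hk]
      have h2 : pV (trn s q) (k + 1) ω = pV (trn s q) k ω := by
        simp [pV, Finset.sum_range_succ, this]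
      rw [h2]; exact ih

theorem trn_eq {q : ℝ} {k : ℕ} {ω : Ω} (hq : pV s k ω ≤ q) (t : ℕ) (ht : t < k) :
    trn s q t ω = s t ω := by
  unfold trn
  rw [if_pos]
  refine le_trans ?_ hq
  unfold pV
  exact Finset.sum_le_sum_of_subset_of_nonneg (Finset.range_subset_range.2 (by omega))
    fun _ _ _ => sq_nonneg _

theorem gauss_char (θ a : ℝ) : ∫ x, Complex.exp ((θ : ℂ) * (a * x) * Complex.I + θ ^ 2 / 2 * a ^ 2)
    ∂(gaussianReal 0 1) = 1 := by
  have h := charFun_gaussianReal (μ := 0) (v := 1) (θ * a)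
  rw [charFun_apply_real] at h
  simp only [Complex.exp_add]
  rw [integral_mul_const]
  have h2 : ∫ x : ℝ, Complex.exp ((θ : ℂ) * (a * x) * Complex.I) ∂(gaussianReal 0 1) =
      Complex.exp (-(θ ^ 2 / 2 * a ^ 2)) := by
    convert h using 2
    · funext x; push_cast; ring_nf
    · push_cast; ring_nf
  rw [h2, ← Complex.exp_add]
  simp

/-- exponential martingale -/
noncomputable def eM {Ω : Type*} (s e : ℕ → Ω → ℝ) (θ : ℝ) (k : ℕ) (ω : Ω) : ℂ :=
  Complex.exp ((θ : ℂ) * (pS s e k ω : ℝ) * Complex.I + θ ^ 2 / 2 * (pV s k ω : ℝ))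

theorem eM_norm (θ : ℝ) (k : ℕ) (ω : Ω) : ‖eM s e θ k ω‖ = Real.exp (θ ^ 2 / 2 * pV s k ω) := by
  rw [eM, Complex.norm_exp]
  congr 1
  have : ((θ : ℂ) * (pS s e k ω : ℝ) * Complex.I + θ ^ 2 / 2 * (pV s k ω : ℝ)) =
    ((θ ^ 2 / 2 * pV s k ω : ℝ) : ℂ) + ((θ * pS s e k ω : ℝ) : ℂ) * Complex.I := by
      push_cast; ring
  rw [this]
  simp [-Complex.ofReal_mul, -Complex.ofReal_div, -Complex.ofReal_pow]

theorem MD.eM_meas (h : MD P F s e) (θ : ℝ) (k : ℕ) : Measurable[F k] (eM s e θ k) := by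
  have h1 := h.pS_meas k
  have h2 := h.pV_meas k k (by omega)
  unfold eM
  apply Complex.measurable_exp.comp
  refine Measurable.add ?_ ?_
  · exact ((Complex.measurable_ofReal.comp h1).const_mul _).mul_const _
  · exact (Complex.measurable_ofReal.comp h2).const_mul _

theorem MD.eM_int [IsProbabilityMeasure P] (h : MD P F s e) {C : ℝ} (hC : ∀ k ω, pV s k ω ≤ C)
    (θ : ℝ) (k : ℕ) : Integrable (eM s e θ k) P := by
  refine Integrable.of_bound (((h.eM_meas θ k).mono (h.le k) le_rfl).aestronglyMeasurable)
    (Real.exp (θ ^ 2 / 2 * C)) (Eventually.of_forall fun ω => ?_)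
  rw [eM_norm]
  have := hC k ω
  gcongr

theorem MD.expo [IsProbabilityMeasure P] (h : MD P F s e) {C : ℝ} (hC : ∀ k ω, pV s k ω ≤ C)
    (θ : ℝ) (k : ℕ) : ∫ ω, eM s e θ k ω ∂P = 1 := by
  induction k with
  | zero => simp [eM, pS, pV]
  | succ k ih =>
    rcases h.gi k with h0 | ⟨hg, hi⟩
    · rw [← ih]
      congr 1
      funext ω
      simp [eM, pS, pV, Finset.sum_range_succ, h0]
    · let W : Ω → ℂ × ℝ := fun ω => (eM s e θ k ω, s k ω)
      have hW : Measurable[F k] W := (h.eM_meas θ k).prodMk (h.smeas k)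
      have hW' : Measurable W := hW.mono (h.le k) le_rfl
      have hind := h.indepFun k hW hi
      have hmap := hind.map_prod_eq_prod_map_map hW'.aemeasurable (h.emeas k).aemeasurable
      rw [hg] at hmap
      let f : (ℂ × ℝ) × ℝ → ℂ := fun p =>
        p.1.1 * Complex.exp ((θ : ℂ) * (p.1.2 * p.2) * Complex.I + θ ^ 2 / 2 * p.1.2 ^ 2)
      have hf : Measurable f := by fun_prop
      have hstep : ∀ ω, eM s e θ (k + 1) ω = f (W ω, e k ω) := by
        intro ω
        simp only [f, W, eM, ← Complex.exp_add]
        congr 1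
        simp only [pS, pV, Finset.sum_range_succ]
        push_cast; ring
      have hpair : Measurable (fun ω => (W ω, e k ω)) := hW'.prodMk (h.emeas k)
      have hIntg : Integrable f (Measure.map (fun ω => (W ω, e k ω)) P) := by
        rw [integrable_map_measure hf.aestronglyMeasurable hpair.aemeasurable]
        refine (h.eM_int hC θ (k + 1)).congr (Eventually.of_forall fun ω => ?_)
        exact hstep ω
      calc ∫ ω, eM s e θ (k + 1) ω ∂P = ∫ ω, f (W ω, e k ω) ∂P := by simp only [hstep]
        _ = ∫ p, f p ∂(Measure.map (fun ω => (W ω, e k ω)) P) :=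
            (integral_map hpair.aemeasurable hf.aestronglyMeasurable).symm
        _ = ∫ p, f p ∂((Measure.map W P).prod (gaussianReal 0 1)) := by rw [hmap]
        _ = ∫ w, ∫ x, f (w, x) ∂(gaussianReal 0 1) ∂(Measure.map W P) := by
            rw [hmap] at hIntg
            have : IsProbabilityMeasure (Measure.map W P) :=
              Measure.isProbabilityMeasure_map hW'.aemeasurable
            exact integral_prod f hIntg
        _ = ∫ w, w.1 ∂(Measure.map W P) := by
            congr 1
            funext w
            simp only [f]
            rw [integral_const_mul, gauss_char, mul_one]
        _ = ∫ ω, eM s e θ k ω ∂P := by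
            rw [integral_map hW'.aemeasurable (by fun_prop)]
        _ = 1 := ih

theorem exp_diff {a b M : ℝ} (ha : a ≤ M) (hb : b ≤ M) :
    |Real.exp a - Real.exp b| ≤ Real.exp M * |a - b| := by
  wlog hab : b ≤ a generalizing a b
  · rw [abs_sub_comm, abs_sub_comm a]
    exact this hb ha (by linarith)
  have h1 := Real.add_one_le_exp (b - a)
  have h2 : Real.exp b = Real.exp a * Real.exp (b - a) := by rw [← Real.exp_add]; ring_nf
  have h3 := Real.exp_le_exp.2 ha
  have h4 := Real.exp_pos a
  rw [abs_of_nonneg (sub_nonneg.2 (Real.exp_le_exp.2 hab)), abs_of_nonneg (sub_nonneg.2 hab), h2]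
  nlinarith

theorem MD.char_bound [IsProbabilityMeasure P] (h : MD P F s e) (θ : ℝ) (k : ℕ) {δ : ℝ}
    (hδ : 0 < δ) (hδ1 : δ ≤ 1) :
    ‖∫ ω, Complex.exp ((θ : ℂ) * (pS s e k ω : ℝ) * Complex.I) ∂P - Complex.exp (-(θ : ℂ) ^ 2 / 2)‖ ≤
      Real.exp (θ ^ 2) * (θ ^ 2 / 2) * δ +
        2 * Real.exp (θ ^ 2) * (P {ω | δ ≤ |pV s k ω - 1|}).toReal := by
  have hT := h.trunc 2
  have hC : ∀ k ω, pV (trn s 2) k ω ≤ 2 := pV_trn_le (by norm_num)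
  have h1 := hT.expo hC θ k
  have hI := hT.eM_int hC θ k
  set B : Set Ω := {ω | δ ≤ |pV s k ω - 1|} with hB
  have hBm : MeasurableSet B := measurableSet_le measurable_const
    (((h.pV_meas' k).sub_const 1).abs)
  have hSm := h.pS_meas' k
  have hJ : Integrable (fun ω => Complex.exp ((θ : ℂ) * (pS s e k ω : ℝ) * Complex.I) *
      Complex.exp ((θ : ℂ) ^ 2 / 2)) P := by
    refine Integrable.mul_const ?_ _
    refine Integrable.of_bound (by fun_prop) 1 (Eventually.of_forall fun ω => ?_)
    rw [← Complex.ofReal_mul, Complex.norm_exp_ofReal_mul_I]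
  have hnE : ‖Complex.exp ((θ : ℂ) ^ 2 / 2)‖ = Real.exp (θ ^ 2 / 2) := by
    have : ((θ : ℂ) ^ 2 / 2) = ((θ ^ 2 / 2 : ℝ) : ℂ) := by push_cast; ring
    rw [this, Complex.norm_exp_ofReal]
  have hE1 : Real.exp (θ ^ 2 / 2) ≤ Real.exp (θ ^ 2) := Real.exp_le_exp.2 (by nlinarith [sq_nonneg θ])
  have hpt : ∀ ω, ‖Complex.exp ((θ : ℂ) * (pS s e k ω : ℝ) * Complex.I) *
      Complex.exp ((θ : ℂ) ^ 2 / 2) - eM (trn s 2) e θ k ω‖ ≤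
      Real.exp (θ ^ 2) * (θ ^ 2 / 2) * δ + B.indicator (fun _ => 2 * Real.exp (θ ^ 2)) ω := by
    intro ω
    by_cases hω : ω ∈ B
    · rw [Set.indicator_of_mem hω]
      have a1 : ‖Complex.exp ((θ : ℂ) * (pS s e k ω : ℝ) * Complex.I) *
        Complex.exp ((θ : ℂ) ^ 2 / 2)‖ ≤ Real.exp (θ ^ 2) := by
        rw [norm_mul, ← Complex.ofReal_mul, Complex.norm_exp_ofReal_mul_I, one_mul, hnE]
        exact hE1
      have a2 : ‖eM (trn s 2) e θ k ω‖ ≤ Real.exp (θ ^ 2) := by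
        rw [eM_norm]
        apply Real.exp_le_exp.2
        nlinarith [sq_nonneg θ, hC k ω]
      have a3 := norm_sub_le (Complex.exp ((θ : ℂ) * (pS s e k ω : ℝ) * Complex.I) *
        Complex.exp ((θ : ℂ) ^ 2 / 2)) (eM (trn s 2) e θ k ω)
      have a4 : 0 ≤ Real.exp (θ ^ 2) * (θ ^ 2 / 2) * δ := by positivity
      linarith
    · rw [Set.indicator_of_notMem hω, add_zero]
      have hω' : |pV s k ω - 1| < δ := not_le.1 hω
      have hV : pV s k ω ≤ 2 := by have := (abs_lt.1 hω').2; linarith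
      have hpS : pS (trn s 2) e k ω = pS s e k ω :=
        Finset.sum_congr rfl fun t ht => by rw [trn_eq hV t (Finset.mem_range.1 ht)]
      have hpV : pV (trn s 2) k ω = pV s k ω :=
        Finset.sum_congr rfl fun t ht => by rw [trn_eq hV t (Finset.mem_range.1 ht)]
      rw [eM, hpS, hpV, Complex.exp_add, ← mul_sub, norm_mul, ← Complex.ofReal_mul,
        Complex.norm_exp_ofReal_mul_I, one_mul]
      have b1 : Complex.exp ((θ : ℂ) ^ 2 / 2) - Complex.exp ((θ : ℂ) ^ 2 / 2 * (pV s k ω : ℝ)) =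
          ((Real.exp (θ ^ 2 / 2) - Real.exp (θ ^ 2 / 2 * pV s k ω) : ℝ) : ℂ) := by
        push_cast; ring_nf
      rw [b1, Complex.norm_real, Real.norm_eq_abs]
      refine (exp_diff (M := θ ^ 2) (by nlinarith [sq_nonneg θ]) (by nlinarith [sq_nonneg θ])).trans ?_
      have b2 : |θ ^ 2 / 2 - θ ^ 2 / 2 * pV s k ω| = θ ^ 2 / 2 * |pV s k ω - 1| := by
        rw [abs_sub_comm, ← mul_sub_one, abs_mul, abs_of_nonneg (by positivity : 0 ≤ θ ^ 2 / 2)]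
      rw [b2, ← mul_assoc]
      gcongr
  have hmain : ‖(∫ ω, Complex.exp ((θ : ℂ) * (pS s e k ω : ℝ) * Complex.I) ∂P) *
      Complex.exp ((θ : ℂ) ^ 2 / 2) - 1‖ ≤ Real.exp (θ ^ 2) * (θ ^ 2 / 2) * δ +
        2 * Real.exp (θ ^ 2) * (P B).toReal := by
    rw [← integral_mul_const, ← h1, ← integral_sub hJ hI]
    have hbi : Integrable (fun ω => Real.exp (θ ^ 2) * (θ ^ 2 / 2) * δ +
        B.indicator (fun _ => 2 * Real.exp (θ ^ 2)) ω) P :=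
      (integrable_const _).add ((integrable_const _).indicator hBm)
    refine (norm_integral_le_of_norm_le hbi (Eventually.of_forall hpt)).trans ?_
    rw [integral_add (integrable_const _) ((integrable_const _).indicator hBm),
      integral_indicator hBm]
    simp [Measure.real, mul_comm]
  have hfac : (∫ ω, Complex.exp ((θ : ℂ) * (pS s e k ω : ℝ) * Complex.I) ∂P) -
      Complex.exp (-(θ : ℂ) ^ 2 / 2) =
      ((∫ ω, Complex.exp ((θ : ℂ) * (pS s e k ω : ℝ) * Complex.I) ∂P) *
      Complex.exp ((θ : ℂ) ^ 2 / 2) - 1) * Complex.exp (-(θ : ℂ) ^ 2 / 2) := by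
    rw [sub_mul, mul_assoc, ← Complex.exp_add]
    have : (θ : ℂ) ^ 2 / 2 + -(θ : ℂ) ^ 2 / 2 = 0 := by ring
    rw [this]; simp
  rw [hfac, norm_mul]
  have hn : ‖Complex.exp (-(θ : ℂ) ^ 2 / 2)‖ ≤ 1 := by
    have : (-(θ : ℂ) ^ 2 / 2) = ((-(θ ^ 2 / 2) : ℝ) : ℂ) := by push_cast; ring
    rw [this, Complex.norm_exp_ofReal, Real.exp_le_one_iff]
    nlinarith [sq_nonneg θ]
  calc _ ≤ (Real.exp (θ ^ 2) * (θ ^ 2 / 2) * δ +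
        2 * Real.exp (θ ^ 2) * (P B).toReal) * 1 := by gcongr
    _ = _ := mul_one _

end MDchar


theorem gauss_small (η : ENNReal) (hη : 0 < η) :
    ∃ κ : ℝ, 0 < κ ∧ gaussianReal 0 1 (Set.Icc (-κ) κ) < η := by
  have hna : NullSingletonClass (gaussianReal 0 1) :=
    nullSingletonClass_gaussianReal (by norm_num)
  have ht : Tendsto (fun j : ℕ => gaussianReal 0 1 (Set.Icc (-(1 / ((j : ℝ) + 1))) (1 / ((j : ℝ) + 1))))
      atTop (nhds (gaussianReal 0 1 (⋂ j : ℕ, Set.Icc (-(1 / ((j : ℝ) + 1))) (1 / ((j : ℝ) + 1))))) := by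
    refine tendsto_measure_iInter_atTop (fun j => measurableSet_Icc.nullMeasurableSet) ?_ ⟨0, by finiteness⟩
    intro i j hij
    have : (1 / ((j : ℝ) + 1)) ≤ 1 / ((i : ℝ) + 1) := by
      have : (i : ℝ) ≤ j := by exact_mod_cast hij
      gcongr
    exact Set.Icc_subset_Icc (by linarith) this
  have hset : (⋂ j : ℕ, Set.Icc (-(1 / ((j : ℝ) + 1))) (1 / ((j : ℝ) + 1))) ⊆ {(0 : ℝ)} := by
    intro x hx
    simp only [Set.mem_iInter, Set.mem_Icc] at hx
    have t1 := tendsto_one_div_add_atTop_nhds_zero_nat (𝕜 := ℝ)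
    have a1 : x ≤ 0 := ge_of_tendsto' t1 fun j => (hx j).2
    have a2 : -0 ≤ x := le_of_tendsto' t1.neg fun j => (hx j).1
    simp only [Set.mem_singleton_iff]
    linarith
  have hz : gaussianReal 0 1 (⋂ j : ℕ, Set.Icc (-(1 / ((j : ℝ) + 1))) (1 / ((j : ℝ) + 1))) = 0 :=
    measure_mono_null hset (measure_singleton _)
  rw [hz] at ht
  obtain ⟨j, hj⟩ := ((tendsto_order.1 ht).2 η hη).exists
  exact ⟨1 / ((j : ℝ) + 1), by positivity, hj⟩

theorem smallball {Ω : Type*} [MeasurableSpace Ω] (P : ℕ → Measure Ω)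
    (hP : ∀ n, IsProbabilityMeasure (P n))
    (F : ℕ → ℕ → MeasurableSpace Ω) (s e : ℕ → ℕ → Ω → ℝ)
    (h : ∀ n, MD (P n) (F n) (s n) (e n)) (k : ℕ → ℕ) (q : ℕ → ℝ) (hq : ∀ᶠ n in atTop, 0 < q n)
    (hV : ∀ δ : ℝ, 0 < δ → Tendsto (fun n => P n {ω | δ ≤ |pV (s n) (k n) ω / q n - 1|})
      atTop (nhds 0)) (η : ENNReal) (hη : 0 < η) :
    ∃ κ : ℝ, 0 < κ ∧ ∀ᶠ n in atTop, P n {ω | |pS (s n) (e n) (k n) ω| ≤ κ * √(q n)} ≤ η := by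
  have h' : ∀ n, MD (P n) (F n) (fun t ω => (√(q n))⁻¹ * s n t ω) (e n) :=
    fun n => (h n).weight fun _ => (√(q n))⁻¹
  have hpS : ∀ n ω, pS (fun t ω => (√(q n))⁻¹ * s n t ω) (e n) (k n) ω =
      (√(q n))⁻¹ * pS (s n) (e n) (k n) ω := by
    intro n ω; simp only [pS, Finset.mul_sum, mul_assoc]
  have hpV : ∀ n, 0 < q n → ∀ ω, pV (fun t ω => (√(q n))⁻¹ * s n t ω) (k n) ω =
      pV (s n) (k n) ω / q n := by
    intro n hn ω
    simp only [pV, mul_pow, ← Finset.mul_sum, inv_pow, Real.sq_sqrt hn.le]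
    ring
  let Z : ℕ → Ω → ℝ := fun n => pS (fun t ω => (√(q n))⁻¹ * s n t ω) (e n) (k n)
  have hZ : ∀ n, Measurable (Z n) := fun n => (h' n).pS_meas' (k n)
  let μ : ℕ → ProbabilityMeasure ℝ := fun n =>
    ⟨Measure.map (Z n) (P n), Measure.isProbabilityMeasure_map (hZ n).aemeasurable⟩
  let μ0 : ProbabilityMeasure ℝ := ⟨gaussianReal 0 1, inferInstance⟩
  have hchar : Tendsto μ atTop (nhds μ0) := by
    rw [ProbabilityMeasure.tendsto_iff_tendsto_charFun]
    intro θ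
    have e0 : charFun (μ0 : Measure ℝ) θ = Complex.exp (-(θ : ℂ) ^ 2 / 2) := by
      change charFun (gaussianReal 0 1) θ = _
      rw [charFun_gaussianReal]
      congr 1; push_cast; ring
    rw [e0, tendsto_iff_norm_sub_tendsto_zero]
    have e1 : ∀ n, charFun (μ n : Measure ℝ) θ =
        ∫ ω, Complex.exp ((θ : ℂ) * (Z n ω : ℝ) * Complex.I) ∂(P n) := by
      intro n
      change charFun (Measure.map (Z n) (P n)) θ = _
      rw [charFun_apply_real, integral_map (hZ n).aemeasurable (by fun_prop)]
    rw [Metric.tendsto_atTop']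
    intro ρ hρ
    set A := Real.exp (θ ^ 2) * (θ ^ 2 / 2) with hA
    have hA0 : 0 ≤ A := by positivity
    set δ : ℝ := min 1 (ρ / (2 * (A + 1))) with hδ
    have hδ0 : 0 < δ := by positivity
    have hAδ : A * δ < ρ / 2 := by
      have : δ ≤ ρ / (2 * (A + 1)) := min_le_right _ _
      have h3 : (A + 1) * δ ≤ ρ / 2 := by
        calc (A + 1) * δ ≤ (A + 1) * (ρ / (2 * (A + 1))) := by gcongr
          _ = ρ / 2 := by field_simp
      nlinarith
    have hVt := (ENNReal.tendsto_toReal (by simp)).comp (hV δ hδ0)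
    have hVt2 := (hVt.const_mul (2 * Real.exp (θ ^ 2)))
    simp only [ENNReal.toReal_zero, mul_zero] at hVt2
    have hev := (tendsto_order.1 hVt2).2 (ρ / 2) (by positivity)
    have hev2 := (hev.and hq)
    obtain ⟨N, hN⟩ := eventually_atTop.1 hev2
    refine ⟨N, fun n hn => ?_⟩
    obtain ⟨hn1, hn2⟩ := hN n hn.le
    have hP' := hP n
    have hb := (h' n).char_bound θ (k n) hδ0 (min_le_left _ _)
    simp only [hpV n hn2, ← hA] at hb
    rw [Real.dist_eq, sub_zero, abs_norm, e1 n]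
    simp only [Function.comp] at hn1
    calc _ ≤ _ := hb
      _ < ρ := by linarith
  obtain ⟨κ, hκ, hκη⟩ := gauss_small η hη
  refine ⟨κ, hκ, ?_⟩
  have hls := ProbabilityMeasure.limsup_measure_closed_le_of_tendsto hchar
    (F := Set.Icc (-κ) κ) isClosed_Icc
  have hlt := eventually_lt_of_limsup_lt (hls.trans_lt hκη)
  filter_upwards [hlt, hq] with n hn hqn
  refine le_trans ?_ hn.le
  change _ ≤ Measure.map (Z n) (P n) (Set.Icc (-κ) κ)
  rw [Measure.map_apply (hZ n) measurableSet_Icc]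
  refine measure_mono fun ω hω => ?_
  simp only [Set.mem_ofPred_eq] at hω
  simp only [Set.mem_preimage, Z, hpS]
  rw [Set.mem_Icc, ← abs_le, abs_mul, abs_of_nonneg (by positivity), inv_mul_le_iff₀ (by positivity)]
  linarith

theorem MD.markov {Ω : Type*} [MeasurableSpace Ω] {P : Measure Ω} {F : ℕ → MeasurableSpace Ω}
    {s e : ℕ → Ω → ℝ} (h : MD P F s e) (n : ℕ) {lam : ℝ} (hl : 0 < lam) :
    P {ω | lam ≤ ∑ t ∈ Finset.range n, (s t ω * e t ω) ^ 2} ≤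
      ENNReal.ofReal ((∑ t ∈ Finset.range n, ∫ ω, (s t ω) ^ 2 ∂P) / lam) := by
  have hi : Integrable (fun ω => ∑ t ∈ Finset.range n, (s t ω * e t ω) ^ 2) P :=
    integrable_finsetSum _ fun t _ => (h.usq t).1
  have hm := mul_meas_ge_le_lintegral₀ (μ := P)
    (f := fun ω => ENNReal.ofReal (∑ t ∈ Finset.range n, (s t ω * e t ω) ^ 2))
    hi.aemeasurable.ennreal_ofReal (ENNReal.ofReal lam)
  rw [← ofReal_integral_eq_lintegral_ofReal hi
    (Eventually.of_forall fun ω => Finset.sum_nonneg fun _ _ => sq_nonneg _),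
    integral_finsetSum _ fun t _ => (h.usq t).1] at hm
  simp only [(h.usq _).2] at hm
  rw [ENNReal.ofReal_div_of_pos hl, ENNReal.le_div_iff_mul_le (by left; positivity) (by left; simp),
    mul_comm]
  refine le_trans ?_ hm
  refine mul_le_mul' le_rfl (measure_mono fun ω hω => ?_)
  exact ENNReal.ofReal_le_ofReal hω


theorem sum_Icc_shift {M : Type*} [AddCommMonoid M] (f : ℕ → M) (k : ℕ) :
    ∑ t ∈ Finset.Icc 1 k, f t = ∑ t ∈ Finset.range k, f (t + 1) := by
  induction k with
  | zero => simp
  | succ k ih => rw [Finset.sum_Icc_succ_top (by omega), ih, Finset.sum_range_succ]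

/-- path mean -/
noncomputable def mb (y : ℕ → ℝ) (τ : ℕ) : ℝ := (∑ j ∈ Finset.range τ, y j) / τ

/-- path denominator -/
noncomputable def dn (y : ℕ → ℝ) (τ : ℕ) : ℝ := ∑ j ∈ Finset.range τ, (y j - mb y τ) ^ 2

/-- path numerator -/
noncomputable def nm (y : ℕ → ℝ) (τ : ℕ) : ℝ :=
  ∑ j ∈ Finset.range τ, (y j - mb y τ) * (y (j + 1) - y j)

theorem sum_dev (y : ℕ → ℝ) {τ : ℕ} (hτ : 0 < τ) : ∑ j ∈ Finset.range τ, (y j - mb y τ) = 0 := by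
  have : (τ : ℝ) ≠ 0 := by positivity
  rw [Finset.sum_sub_distrib, Finset.sum_const, Finset.card_range, nsmul_eq_mul, mb]
  field_simp
  ring

theorem stat_eq {Ω : Type*} (X : ℕ → Ω → ℝ) {τ : ℕ} (hτ : 0 < τ) (ω : Ω)
    (hd : dn (fun j => X j ω) τ ≠ 0) :
    svadfDelta X τ ω = τ * (nm (fun j => X j ω) τ / dn (fun j => X j ω) τ) := by
  set y : ℕ → ℝ := fun j => X j ω with hy
  have hxb : xbar X τ ω = mb y τ := by
    unfold xbar mb
    rw [sum_Icc_shift]; simp [hy]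
  have h1 : ∑ j ∈ Finset.Icc 1 τ, xtil X τ (j - 1) ω * X j ω = nm y τ + dn y τ := by
    rw [sum_Icc_shift]
    simp only [xtil, hxb, Nat.add_sub_cancel]
    have h0 := sum_dev y hτ
    have : ∀ j, (X j ω - mb y τ) * X (j + 1) ω = (y j - mb y τ) * (y (j + 1) - y j) +
        (y j - mb y τ) ^ 2 + mb y τ * (y j - mb y τ) := by
      intro j; simp only [hy]; ring
    simp only [this]
    rw [Finset.sum_add_distrib, Finset.sum_add_distrib, ← Finset.mul_sum, h0]
    simp [nm, dn]
  have h2 : ∑ j ∈ Finset.Icc 1 τ, (xtil X τ (j - 1) ω) ^ 2 = dn y τ := by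
    rw [sum_Icc_shift]
    simp only [xtil, hxb, Nat.add_sub_cancel]
    rfl
  unfold svadfDelta deltaHat
  rw [h1, h2]
  field_simp
  ring

theorem nm_eq (y : ℕ → ℝ) (τ : ℕ) : nm y τ = (y τ ^ 2 - y 0 ^ 2 -
    ∑ j ∈ Finset.range τ, (y (j + 1) - y j) ^ 2) / 2 - mb y τ * (y τ - y 0) := by
  have h1 : ∑ j ∈ Finset.range τ, (y (j + 1) - y j) = y τ - y 0 := Finset.sum_range_sub y τ
  have h2 : ∑ j ∈ Finset.range τ, (y (j + 1) ^ 2 - y j ^ 2) = y τ ^ 2 - y 0 ^ 2 :=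
    Finset.sum_range_sub (fun j => y j ^ 2) τ
  rw [← h1, ← h2, ← Finset.sum_sub_distrib, Finset.mul_sum, Finset.sum_div, ← Finset.sum_sub_distrib]
  unfold nm
  exact Finset.sum_congr rfl fun j _ => by ring

theorem mb_abs_le (y : ℕ → ℝ) {τ : ℕ} {B : ℝ} (hB : ∀ j < τ, |y j| ≤ B) (hB0 : 0 ≤ B) :
    |mb y τ| ≤ B := by
  unfold mb
  rw [abs_div, Nat.abs_cast]
  refine div_le_of_le_mul₀ (by positivity) hB0 ?_
  calc |∑ j ∈ Finset.range τ, y j| ≤ ∑ j ∈ Finset.range τ, |y j| := Finset.abs_sum_le_sum_abs _ _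
    _ ≤ ∑ j ∈ Finset.range τ, B := Finset.sum_le_sum fun j hj => hB j (Finset.mem_range.1 hj)
    _ = B * τ := by simp [mul_comm]

theorem mb_shift (y : ℕ → ℝ) (a : ℝ) {τ : ℕ} (hτ : 0 < τ) : mb (fun j => y j - a) τ = mb y τ - a := by
  have : (τ : ℝ) ≠ 0 := by positivity
  unfold mb
  rw [Finset.sum_sub_distrib, Finset.sum_const, Finset.card_range, nsmul_eq_mul]
  field_simp

theorem D1 {Ω : Type*} (X : ℕ → Ω → ℝ) (ω : Ω) {τ b l : ℕ} {K κ S : ℝ} (hK : 0 < K) (hκ : 0 < κ)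
    (hS : 0 < S) (hl : 0 < l) (hτ : b + l ≤ τ)
    (z : ℕ → ℝ) (hz : ∀ j ≤ τ, X j ω = X 0 ω + z j)
    (hzK : ∀ j ≤ τ, |z j| ≤ K * S) (hzb : 4 * κ * S ≤ |z b|)
    (h1 : ∀ j < l, |z j| ≤ κ * S) (h2 : ∀ j, b ≤ j → j < b + l → |z j - z b| ≤ κ * S) :
    svadfDelta X τ ω ≤ τ * (3 / 2 * K ^ 2 / (l * κ ^ 2)) := by
  have hτ0 : 0 < τ := by omega
  set y : ℕ → ℝ := fun j => X j ω with hy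
  have hz0 : z 0 = 0 := by have := hz 0 (by omega); linarith
  have hzb' : |mb z τ| ≤ K * S := mb_abs_le z (fun j hj => hzK j hj.le) (by positivity)
  have hmb : mb y τ = mb z τ + y 0 := by
    have h3 := mb_shift y (y 0) hτ0
    have h4 : mb (fun j => y j - y 0) τ = mb z τ := by
      unfold mb
      congr 1
      exact Finset.sum_congr rfl fun j hj => by
        have := hz j (Finset.mem_range.1 hj).le
        simp only [hy]; linarith
    linarith
  have hnum : nm y τ ≤ 3 / 2 * K ^ 2 * S ^ 2 := by
    rw [nm_eq, hmb]
    have e1 : y τ = y 0 + z τ := hz τ le_rfl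
    have e2 : 0 ≤ ∑ j ∈ Finset.range τ, (y (j + 1) - y j) ^ 2 :=
      Finset.sum_nonneg fun _ _ => sq_nonneg _
    have e3 := hzK τ le_rfl
    have e4 : z τ ^ 2 ≤ (K * S) ^ 2 := by rw [← sq_abs]; gcongr
    have e5 : -(mb z τ * z τ) ≤ (K * S) ^ 2 := by
      calc -(mb z τ * z τ) ≤ |mb z τ * z τ| := neg_le_abs _
        _ = |mb z τ| * |z τ| := abs_mul _ _
        _ ≤ (K * S) * (K * S) := by gcongr
        _ = _ := by ring
    rw [e1]
    nlinarith
  have hblock : ∀ (A : Finset ℕ), A ⊆ Finset.range τ → A.card = l →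
      (∀ j ∈ A, κ * S ≤ |z j - mb z τ|) → (l : ℝ) * κ ^ 2 * S ^ 2 ≤ dn y τ := by
    intro A hA hc hj
    calc (l : ℝ) * κ ^ 2 * S ^ 2 = ∑ j ∈ A, (κ * S) ^ 2 := by
          rw [Finset.sum_const, hc, nsmul_eq_mul]; ring
      _ ≤ ∑ j ∈ A, (y j - mb y τ) ^ 2 := by
          refine Finset.sum_le_sum fun j hjA => ?_
          have e1 := hz j (Finset.mem_range.1 (hA hjA)).le
          have e2 : y j - mb y τ = z j - mb z τ := by rw [hmb]; simp only [hy]; linarith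
          rw [e2, ← sq_abs (z j - mb z τ)]
          have := hj j hjA
          gcongr
      _ ≤ dn y τ := Finset.sum_le_sum_of_subset_of_nonneg hA fun _ _ _ => sq_nonneg _
  have hden : (l : ℝ) * κ ^ 2 * S ^ 2 ≤ dn y τ := by
    by_cases hm : 2 * κ * S ≤ |mb z τ|
    · refine hblock (Finset.range l) (Finset.range_subset_range.2 (by omega)) (by simp) ?_
      intro j hj
      have e1 := h1 j (Finset.mem_range.1 hj)
      have e2 := abs_sub_abs_le_abs_sub (mb z τ) (z j)
      rw [abs_sub_comm] at e2
      linarith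
    · refine hblock (Finset.Ico b (b + l)) ?_ (by simp) ?_
      · intro j hj
        rw [Finset.mem_Ico] at hj
        exact Finset.mem_range.2 (by omega)
      · intro j hj
        rw [Finset.mem_Ico] at hj
        have e1 := h2 j hj.1 hj.2
        have e2 := abs_sub_abs_le_abs_sub (z b) (z b - (z j - mb z τ))
        have e3 : z b - (z b - (z j - mb z τ)) = z j - mb z τ := by ring
        have e4 : |z b - (z j - mb z τ)| ≤ |z j - z b| + |mb z τ| := by
          have := abs_sub (mb z τ) (z j - z b)
          have e5 : mb z τ - (z j - z b) = z b - (z j - mb z τ) := by ring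
          rw [e5] at this
          linarith
        rw [e3] at e2
        push Not at hm
        linarith
  have hl' : (0 : ℝ) < l := by exact_mod_cast hl
  have hpos : (0 : ℝ) < (l : ℝ) * κ ^ 2 * S ^ 2 := by positivity
  rw [stat_eq X hτ0 ω (by linarith)]
  refine mul_le_mul_of_nonneg_left ?_ (by positivity)
  calc nm y τ / dn y τ ≤ (3 / 2 * K ^ 2 * S ^ 2) / (l * κ ^ 2 * S ^ 2) := by
        exact div_le_div₀ (by positivity) hnum hpos hden
    _ = _ := by field_simp

theorem geo_sum {a : ℝ} (ha : 1 < a) (E N : ℕ) :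
    ∑ j ∈ Finset.range (E + N), a ^ (j + 1 - E) ≤ E + a ^ (N + 1) / (a - 1) := by
  have ha' : 0 < a - 1 := by linarith
  induction N with
  | zero =>
    have : ∑ j ∈ Finset.range (E + 0), a ^ (j + 1 - E) = E := by
      rw [Finset.sum_congr rfl (g := fun _ => (1 : ℝ))]
      · simp
      · intro j hj
        have : j + 1 - E = 0 := by have := Finset.mem_range.1 hj; omega
        simp [this]
    rw [this]
    have : 0 ≤ a ^ (0 + 1) / (a - 1) := by positivity
    linarith
  | succ N ih =>
    rw [← add_assoc, Finset.sum_range_succ]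
    have e1 : E + N + 1 - E = N + 1 := by omega
    have e2 : a ^ (N + 1 + 1) / (a - 1) = a ^ (N + 1) / (a - 1) + a ^ (N + 1) := by
      field_simp; ring
    rw [e1, e2]
    linarith

set_option maxHeartbeats 1000000 in
theorem D2 {Ω : Type*} (X : ℕ → Ω → ℝ) (ω : Ω) {E N : ℕ} {φ K κ S : ℝ} (hE : 0 < E)
    (hφ : 0 < φ) (hK : 0 < K) (hκ : 0 < κ) (hS : 0 < S) (u : ℕ → ℝ)
    (hrec : ∀ j < E + N, X (j + 1) ω = X j ω + (if E ≤ j + 1 then φ else 0) * X j ω + u j)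
    (H1 : ∀ j ≤ E + N, |X j ω| ≤ K * S * (1 + φ) ^ (j + 1 - E))
    (H2 : κ * S * (1 + φ) ^ (N + 1) ≤ |X (E + N) ω|)
    (H3 : ∑ j ∈ Finset.range (E + N), u j ^ 2 ≤ K ^ 2 * S ^ 2)
    (c1 : (E : ℝ) * φ ≤ ((1 + φ) ^ (N + 1)) ^ 2) (c2 : 32 * K ≤ κ * (1 + φ) ^ (N + 1))
    (c3 : 32 * K ≤ κ * (φ * ((E + N : ℕ) : ℝ))) (c4 : 64 * φ * K ^ 2 ≤ κ ^ 2) :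
    ((E + N : ℕ) : ℝ) * (φ * κ ^ 2 / (8 * K ^ 2)) ≤ svadfDelta X (E + N) ω := by
  set τ := E + N with hτ
  have hτ0 : 0 < τ := by omega
  have hτR : (0 : ℝ) < (τ : ℝ) := by exact_mod_cast hτ0
  set y : ℕ → ℝ := fun j => X j ω with hy
  set D : ℝ := (1 + φ) ^ (N + 1) with hD
  have hD0 : 0 < D := by positivity
  set T : ℝ := |y τ| with hT
  have hT2 : y τ ^ 2 = T ^ 2 := (sq_abs _).symm
  have HT : κ * S * D ≤ T := H2
  have hT0 : 0 < T := lt_of_lt_of_le (by positivity) HT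
  -- K * S ≤ T / 32
  have hKS : 32 * (K * S) ≤ T := by
    calc 32 * (K * S) = (32 * K) * S := by ring
      _ ≤ (κ * D) * S := by gcongr
      _ = κ * S * D := by ring
      _ ≤ T := HT
  have hy0 : |y 0| ≤ K * S := by
    have := H1 0 (by omega)
    have e : 0 + 1 - E = 0 := by omega
    rw [e, pow_zero, mul_one] at this
    exact this
  -- sum of squares
  have hsq : ∑ j ∈ Finset.range τ, y j ^ 2 ≤ 2 * K ^ 2 * S ^ 2 * D ^ 2 / φ := by
    have e1 : ∑ j ∈ Finset.range τ, y j ^ 2 ≤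
        ∑ j ∈ Finset.range τ, K ^ 2 * S ^ 2 * ((1 + φ) ^ 2) ^ (j + 1 - E) := by
      refine Finset.sum_le_sum fun j hj => ?_
      have := H1 j (Finset.mem_range.1 hj).le
      rw [← sq_abs (y j)]
      calc |y j| ^ 2 ≤ (K * S * (1 + φ) ^ (j + 1 - E)) ^ 2 := by gcongr
        _ = _ := by rw [← pow_mul, mul_comm 2, pow_mul]; ring
    rw [← Finset.mul_sum] at e1
    have e2 := geo_sum (a := (1 + φ) ^ 2) (by nlinarith) E N
    have e3 : ((1 + φ) ^ 2) ^ (N + 1) = D ^ 2 := by rw [hD, ← pow_mul, ← pow_mul, mul_comm]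
    rw [e3] at e2
    have e4 : D ^ 2 / ((1 + φ) ^ 2 - 1) ≤ D ^ 2 / φ := by
      gcongr; nlinarith
    have e5 : (E : ℝ) ≤ D ^ 2 / φ := by rw [le_div_iff₀ hφ]; exact c1
    calc _ ≤ _ := e1
      _ ≤ K ^ 2 * S ^ 2 * (D ^ 2 / φ + D ^ 2 / φ) := by gcongr; linarith
      _ = _ := by ring
  have hmean : |mb y τ| ≤ T / 16 := by
    have e1 : |∑ j ∈ Finset.range τ, y j| ≤
        ∑ j ∈ Finset.range τ, K * S * (1 + φ) ^ (j + 1 - E) :=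
      (Finset.abs_sum_le_sum_abs _ _).trans
        (Finset.sum_le_sum fun j hj => H1 j (Finset.mem_range.1 hj).le)
    rw [← Finset.mul_sum] at e1
    have e2 := geo_sum (a := 1 + φ) (by linarith) E N
    rw [add_sub_cancel_left] at e2
    have e3 : (E : ℝ) ≤ τ := by exact_mod_cast (by omega : E ≤ τ)
    have e4 : 32 * (K * S * (D / φ)) ≤ T * τ := by
      calc 32 * (K * S * (D / φ)) = (32 * K) * (S * D / φ) := by ring
        _ ≤ (κ * (φ * τ)) * (S * D / φ) := by gcongr
        _ = κ * S * D * τ := by field_simp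
        _ ≤ T * τ := by gcongr
    have e5 : 32 * (K * S * (E : ℝ)) ≤ T * τ := by
      calc 32 * (K * S * (E : ℝ)) = (32 * (K * S)) * E := by ring
        _ ≤ T * τ := by gcongr
    have e6 : K * S * ∑ j ∈ Finset.range τ, (1 + φ) ^ (j + 1 - E) ≤ K * S * (E + D / φ) := by
      gcongr
    unfold mb
    rw [abs_div, Nat.abs_cast, div_le_iff₀ hτR]
    rw [mul_add] at e6
    linarith
  have hdel : ∑ j ∈ Finset.range τ, (y (j + 1) - y j) ^ 2 ≤ T ^ 2 * (1 / 16 + 1 / 512) := by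
    have e1 : ∑ j ∈ Finset.range τ, (y (j + 1) - y j) ^ 2 ≤
        ∑ j ∈ Finset.range τ, (2 * φ ^ 2 * y j ^ 2 + 2 * u j ^ 2) := by
      refine Finset.sum_le_sum fun j hj => ?_
      have := hrec j (Finset.mem_range.1 hj)
      have e : y (j + 1) - y j = (if E ≤ j + 1 then φ else 0) * y j + u j := by
        simp only [hy]; linarith
      rw [e]
      split_ifs
      · nlinarith [sq_nonneg (φ * y j - u j)]
      · nlinarith [sq_nonneg (u j), sq_nonneg (φ * y j)]
    rw [Finset.sum_add_distrib, ← Finset.mul_sum, ← Finset.mul_sum] at e1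
    have e2 : 2 * φ ^ 2 * ∑ j ∈ Finset.range τ, y j ^ 2 ≤ T ^ 2 * (1 / 16) := by
      calc 2 * φ ^ 2 * ∑ j ∈ Finset.range τ, y j ^ 2 ≤
          2 * φ ^ 2 * (2 * K ^ 2 * S ^ 2 * D ^ 2 / φ) := by gcongr
        _ = (64 * φ * K ^ 2) * (S * D) ^ 2 / 16 := by field_simp; ring
        _ ≤ κ ^ 2 * (S * D) ^ 2 / 16 := by gcongr
        _ = (κ * S * D) ^ 2 * (1 / 16) := by ring
        _ ≤ T ^ 2 * (1 / 16) := by gcongr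
    have e3 : (32 * (K * S)) ^ 2 ≤ T ^ 2 := by gcongr
    nlinarith
  have hprod : mb y τ * (y τ - y 0) ≤ T ^ 2 / 12 := by
    calc mb y τ * (y τ - y 0) ≤ |mb y τ * (y τ - y 0)| := le_abs_self _
      _ = |mb y τ| * |y τ - y 0| := abs_mul _ _
      _ ≤ (T / 16) * (T + T / 32) := by
          gcongr
          have := abs_sub (y τ) (y 0)
          linarith
      _ ≤ T ^ 2 / 12 := by nlinarith
  have hy02 : y 0 ^ 2 ≤ T ^ 2 / 1024 := by
    have : |y 0| ^ 2 ≤ (T / 32) ^ 2 := by gcongr; linarith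
    rw [sq_abs] at this
    linarith
  have hnum : T ^ 2 / 4 ≤ nm y τ := by
    have hTT : 0 < T ^ 2 := by positivity
    rw [nm_eq, hT2]
    linarith
  have hden0 : 0 ≤ dn y τ := Finset.sum_nonneg fun _ _ => sq_nonneg _
  have hdpos : 0 < dn y τ := by
    rcases hden0.lt_or_eq with h | h
    · exact h
    · exfalso
      have h1 := (Finset.sum_eq_zero_iff_of_nonneg (fun j _ => sq_nonneg (y j - mb y τ))).1 h.symm
      have h2 : nm y τ = 0 := by
        unfold nm
        refine Finset.sum_eq_zero fun j hj => ?_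
        have := pow_eq_zero_iff (two_ne_zero) |>.1 (h1 j hj)
        rw [this, zero_mul]
      have : 0 < T ^ 2 / 4 := by positivity
      linarith
  have hdle : dn y τ ≤ 2 * K ^ 2 * S ^ 2 * D ^ 2 / φ := by
    refine le_trans ?_ hsq
    have h0 := sum_dev y hτ0
    have : dn y τ = ∑ j ∈ Finset.range τ, y j ^ 2 - τ * mb y τ ^ 2 := by
      have e : ∀ j, (y j - mb y τ) ^ 2 = y j ^ 2 - mb y τ ^ 2 - 2 * mb y τ * (y j - mb y τ) := by
        intro j; ring
      unfold dn
      simp only [e]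
      rw [Finset.sum_sub_distrib, Finset.sum_sub_distrib, ← Finset.mul_sum, h0]
      simp
    have : 0 ≤ (τ : ℝ) * mb y τ ^ 2 := by positivity
    linarith
  rw [stat_eq X hτ0 ω hdpos.ne']
  refine mul_le_mul_of_nonneg_left ?_ (by positivity)
  rw [le_div_iff₀ hdpos]
  calc φ * κ ^ 2 / (8 * K ^ 2) * dn y τ ≤ φ * κ ^ 2 / (8 * K ^ 2) * (2 * K ^ 2 * S ^ 2 * D ^ 2 / φ) := by
        gcongr
    _ = (κ * S * D) ^ 2 / 4 := by field_simp; ring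
    _ ≤ T ^ 2 / 4 := by gcongr
    _ ≤ nm y τ := hnum


/-- eventual probability bound -/
def Bd {Ω : Type*} [MeasurableSpace Ω] (P : ℕ → Measure Ω) (A : ℕ → Set Ω) (η : ℝ) : Prop :=
  ∀ᶠ n in atTop, P n (A n) ≤ ENNReal.ofReal η

/-- cumulative variance -/
noncomputable def Vn {Ω : Type*} [MeasurableSpace Ω] (P : ℕ → Measure Ω)
    (s : ℕ → ℕ → Ω → ℝ) (n k : ℕ) : ℝ :=
  ∑ t ∈ Finset.range k, ∫ ω, (s n t ω) ^ 2 ∂(P n)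

section Esec
variable {Ω : Type*} [MeasurableSpace Ω] {P : ℕ → Measure Ω}
  {F : ℕ → ℕ → MeasurableSpace Ω} {s e : ℕ → ℕ → Ω → ℝ}

theorem Bd.union {A B : ℕ → Set Ω} {a b : ℝ} (hA : Bd P A a) (hB : Bd P B b) (ha : 0 ≤ a)
    (hb : 0 ≤ b) : Bd P (fun n => A n ∪ B n) (a + b) := by
  filter_upwards [hA, hB] with n h1 h2
  rw [ENNReal.ofReal_add ha hb]
  exact (measure_union_le _ _).trans (add_le_add h1 h2)

theorem Bd.mono {A B : ℕ → Set Ω} {a : ℝ} (hB : Bd P B a) (h : ∀ᶠ n in atTop, A n ⊆ B n) :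
    Bd P A a := by
  filter_upwards [hB, h] with n h1 h2
  exact (measure_mono h2).trans h1

theorem Bd.of_tendsto {A : ℕ → Set Ω} {a : ℝ} (ha : 0 < a)
    (h : Tendsto (fun n => P n (A n)) atTop (nhds 0)) : Bd P A a :=
  (ENNReal.tendsto_nhds_zero.1 h) _ (by simpa using ha)

theorem Vn_mono (n : ℕ) {a b : ℕ} (hab : a ≤ b) : Vn P s n a ≤ Vn P s n b := by
  unfold Vn
  refine Finset.sum_le_sum_of_subset_of_nonneg (Finset.range_mono hab) fun t _ _ => ?_
  exact integral_nonneg fun ω => sq_nonneg _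

theorem Vn_nonneg (n a : ℕ) : 0 ≤ Vn P s n a :=
  Finset.sum_nonneg fun t _ => integral_nonneg fun ω => sq_nonneg _

theorem wdoob (hP : ∀ n, IsProbabilityMeasure (P n)) (h : ∀ n, MD (P n) (F n) (s n) (e n))
    (hv : ∀ᶠ n in atTop, 0 < Vn P s n n) (w : ℕ → ℕ → ℝ) (m : ℕ → ℕ) {κ η : ℝ} (hκ : 0 < κ)
    (hη : 0 < η)
    (hb : ∀ᶠ n in atTop, ∑ t ∈ Finset.range (m n), (w n t) ^ 2 * ∫ ω, (s n t ω) ^ 2 ∂(P n) ≤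
      κ ^ 2 * η * Vn P s n n) :
    Bd P (fun n => {ω | ∃ k ≤ m n, κ * √(Vn P s n n) ≤
      |pS (fun t ω => w n t * s n t ω) (e n) k ω|}) η := by
  filter_upwards [hv, hb] with n hv hb
  have := hP n
  have hs : 0 < √(Vn P s n n) := Real.sqrt_pos.2 hv
  refine (((h n).weight (w n)).doob (m n) (lam := κ * √(Vn P s n n)) (by positivity)).trans ?_
  apply ENNReal.ofReal_le_ofReal
  have : ∀ t, ∫ ω, (w n t * s n t ω) ^ 2 ∂(P n) = (w n t) ^ 2 * ∫ ω, (s n t ω) ^ 2 ∂(P n) := by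
    intro t
    simp only [mul_pow, integral_const_mul]
  simp only [this]
  rw [mul_pow, Real.sq_sqrt hv.le, div_le_iff₀ (by positivity)]
  linarith

theorem maxb (hP : ∀ n, IsProbabilityMeasure (P n)) (h : ∀ n, MD (P n) (F n) (s n) (e n))
    (hv : ∀ᶠ n in atTop, 0 < Vn P s n n) {η : ℝ} (hη : 0 < η) :
    ∃ K : ℝ, 1 ≤ K ∧ Bd P (fun n => {ω | ∃ k ≤ n, K * √(Vn P s n n) ≤
      |pS (s n) (e n) k ω|}) η ∧
      Bd P (fun n => {ω | K ^ 2 * Vn P s n n ≤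
        ∑ t ∈ Finset.range n, (s n t ω * e n t ω) ^ 2}) η := by
  have hK : 1 ≤ (1 + 1 / η) ^ 2 * η := by
    have : (1 + 1 / η) ^ 2 * η = η + 2 + 1 / η := by field_simp; ring
    rw [this]; have : 0 < 1 / η := by positivity
    linarith
  refine ⟨1 + 1 / η, by have : 0 < 1 / η := by positivity
                        linarith, ?_, ?_⟩
  · have := wdoob hP h hv (fun _ _ => 1) (fun n => n) (κ := 1 + 1 / η) (by positivity) hη (by
      filter_upwards [hv] with n hv
      simp only [one_pow, one_mul]
      change Vn P s n n ≤ _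
      nlinarith)
    simpa only [one_mul] using this
  · filter_upwards [hv] with n hv
    refine ((h n).markov n (lam := (1 + 1 / η) ^ 2 * Vn P s n n) (by positivity)).trans ?_
    apply ENNReal.ofReal_le_ofReal
    change Vn P s n n / _ ≤ _
    rw [div_le_iff₀ (by positivity)]
    nlinarith

theorem osc (hP : ∀ n, IsProbabilityMeasure (P n)) (h : ∀ n, MD (P n) (F n) (s n) (e n))
    (hv : ∀ᶠ n in atTop, 0 < Vn P s n n) (a b : ℕ → ℕ) (hab : ∀ n, a n ≤ b n) {κ η : ℝ}
    (hκ : 0 < κ) (hη : 0 < η)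
    (hb : ∀ᶠ n in atTop, Vn P s n (b n) - Vn P s n (a n) ≤ κ ^ 2 * η * Vn P s n n) :
    Bd P (fun n => {ω | ∃ j, a n ≤ j ∧ j ≤ b n ∧ κ * √(Vn P s n n) ≤
      |pS (s n) (e n) j ω - pS (s n) (e n) (a n) ω|}) η := by
  refine (wdoob hP h hv (fun n t => if a n ≤ t then 1 else 0) b hκ hη ?_).mono ?_
  · filter_upwards [hb] with n hb
    refine le_trans (le_of_eq ?_) hb
    unfold Vn
    rw [← Finset.sum_range_add_sum_Ico _ (hab n), ← Finset.sum_range_add_sum_Ico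
      (fun t => ∫ ω, (s n t ω) ^ 2 ∂(P n)) (hab n), add_sub_cancel_left,
      Finset.sum_eq_zero (s := Finset.range (a n)), zero_add]
    · refine Finset.sum_congr rfl fun t ht => ?_
      rw [if_pos (Finset.mem_Ico.1 ht).1]; ring
    · intro t ht
      rw [if_neg (by have := Finset.mem_range.1 ht; omega)]; ring
  · refine Eventually.of_forall fun n ω => ?_
    rintro ⟨j, h1, h2, h3⟩
    refine ⟨j, h2, ?_⟩
    convert h3 using 2
    unfold pS
    rw [← Finset.sum_range_add_sum_Ico _ h1, ← Finset.sum_range_add_sum_Ico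
      (fun t => s n t ω * e n t ω) h1, add_sub_cancel_left,
      Finset.sum_eq_zero (s := Finset.range (a n)), zero_add]
    · refine Finset.sum_congr rfl fun t ht => ?_
      beta_reduce
      rw [if_pos (Finset.mem_Ico.1 ht).1]; ring
    · intro t ht
      beta_reduce
      rw [if_neg (by have := Finset.mem_range.1 ht; omega)]; ring

theorem Vdiff (hv : ∀ᶠ n in atTop, 0 < Vn P s n n)
    (hVr : ∀ r ∈ Set.Icc (0 : ℝ) 1, Tendsto (fun n : ℕ => Vn P s n ⌊(n : ℝ) * r⌋₊ / Vn P s n n)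
      atTop (nhds r)) {r1 r2 δ : ℝ} (h0 : 0 ≤ r1) (h12 : r1 ≤ r2) (h1 : r2 ≤ 1) (hδ : r2 - r1 < δ) :
    ∀ᶠ n : ℕ in atTop, Vn P s n ⌊(n : ℝ) * r2⌋₊ - Vn P s n ⌊(n : ℝ) * r1⌋₊ ≤ δ * Vn P s n n := by
  have := (hVr r2 ⟨h0.trans h12, h1⟩).sub (hVr r1 ⟨h0, h12.trans h1⟩)
  filter_upwards [hv, this.eventually (gt_mem_nhds hδ)] with n hv hn
  rw [← sub_div, div_lt_iff₀ hv] at hn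
  exact hn.le

theorem sball (hP : ∀ n, IsProbabilityMeasure (P n)) (h : ∀ n, MD (P n) (F n) (s n) (e n))
    (hv : ∀ᶠ n in atTop, 0 < Vn P s n n)
    (hVr : ∀ r ∈ Set.Icc (0 : ℝ) 1, Tendsto (fun n : ℕ => Vn P s n ⌊(n : ℝ) * r⌋₊ / Vn P s n n)
      atTop (nhds r))
    (hA : ∀ r ∈ Set.Ioc (0 : ℝ) 1, ∀ δ : ℝ, 0 < δ → Tendsto (fun n : ℕ => P n {ω | δ ≤
      |pV (s n) ⌊(n : ℝ) * r⌋₊ ω / Vn P s n ⌊(n : ℝ) * r⌋₊ - 1|}) atTop (nhds 0))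
    {r η : ℝ} (hr : r ∈ Set.Ioc (0 : ℝ) 1) (hη : 0 < η) :
    ∃ κ : ℝ, 0 < κ ∧ Bd P (fun n => {ω | |pS (s n) (e n) ⌊(n : ℝ) * r⌋₊ ω| ≤
      κ * √(Vn P s n n)}) η := by
  have hr0 := hr.1
  have hlow : ∀ᶠ n : ℕ in atTop, r / 2 * Vn P s n n ≤ Vn P s n ⌊(n : ℝ) * r⌋₊ := by
    filter_upwards [hv, (hVr r ⟨hr.1.le, hr.2⟩).eventually (lt_mem_nhds (half_lt_self hr0))] with n h1 h2
    rw [lt_div_iff₀ h1] at h2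
    exact h2.le
  obtain ⟨κ, hκ, hb⟩ := smallball P hP F s e h (fun n => ⌊(n : ℝ) * r⌋₊)
    (fun n => Vn P s n ⌊(n : ℝ) * r⌋₊)
    (by filter_upwards [hv, hlow] with n h1 h2; exact lt_of_lt_of_le (by positivity) h2)
    (hA r hr) (ENNReal.ofReal η) (by simpa using hη)
  refine ⟨κ * √(r / 2), by positivity, ?_⟩
  refine Bd.mono (B := fun n => {ω | |pS (s n) (e n) ⌊(n : ℝ) * r⌋₊ ω| ≤
      κ * √(Vn P s n ⌊(n : ℝ) * r⌋₊)}) hb ?_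
  filter_upwards [hlow] with n hn
  intro ω hω
  refine le_trans (Set.mem_ofPred_eq ▸ hω) ?_
  rw [mul_assoc, ← Real.sqrt_mul (by positivity)]
  gcongr

end Esec

section Gsec
variable {Ω : Type*} [MeasurableSpace Ω] {P : ℕ → Measure Ω}
  {F : ℕ → ℕ → MeasurableSpace Ω} {s e : ℕ → ℕ → Ω → ℝ}

theorem floor_mul_mono (n : ℕ) {a b : ℝ} (hab : a ≤ b) : ⌊(n : ℝ) * a⌋₊ ≤ ⌊(n : ℝ) * b⌋₊ :=
  Nat.floor_mono (mul_le_mul_of_nonneg_left hab (Nat.cast_nonneg n))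

theorem floor_mul_le (n : ℕ) {b : ℝ} (hb : b ≤ 1) : ⌊(n : ℝ) * b⌋₊ ≤ n := by
  have := floor_mul_mono n hb
  simpa using this

theorem floor_gap {a b : ℝ} (ha : 0 ≤ a) (hab : a < b) : ∀ᶠ n : ℕ in atTop,
    (n : ℝ) * ((b - a) / 2) ≤ (⌊(n : ℝ) * b⌋₊ : ℝ) - (⌊(n : ℝ) * a⌋₊ : ℝ) := by
  have hd : 0 < (b - a) / 2 := by linarith
  filter_upwards [(tendsto_natCast_atTop_atTop (R := ℝ)).eventually_ge_atTop (1 / ((b - a) / 2))] with n hn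
  rw [div_le_iff₀ hd] at hn
  have h1 := Nat.lt_floor_add_one ((n : ℝ) * b)
  have h2 := Nat.floor_le (a := (n : ℝ) * a) (by positivity)
  nlinarith

theorem part1 (hP : ∀ n, IsProbabilityMeasure (P n)) (h : ∀ n, MD (P n) (F n) (s n) (e n))
    (hv : ∀ᶠ n in atTop, 0 < Vn P s n n)
    (hVr : ∀ r ∈ Set.Icc (0 : ℝ) 1, Tendsto (fun n : ℕ => Vn P s n ⌊(n : ℝ) * r⌋₊ / Vn P s n n)
      atTop (nhds r))
    (hA : ∀ r ∈ Set.Ioc (0 : ℝ) 1, ∀ δ : ℝ, 0 < δ → Tendsto (fun n : ℕ => P n {ω | δ ≤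
      |pV (s n) ⌊(n : ℝ) * r⌋₊ ω / Vn P s n ⌊(n : ℝ) * r⌋₊ - 1|}) atTop (nhds 0))
    (X : ℕ → ℕ → Ω → ℝ) {r0 re : ℝ} (hr0 : 0 < r0) (hre : re ≤ 1) (hr0e : r0 < re)
    (hX : ∀ n j : ℕ, j < ⌊(n : ℝ) * re⌋₊ → ∀ ω, X n j ω = X n 0 ω + pS (s n) (e n) j ω)
    (cv : ℕ → ℝ) (hcv : Tendsto cv atTop atTop) {η : ℝ} (hη : 0 < η) :
    Bd P (fun n => {ω | ∃ τ, ⌊(n : ℝ) * r0⌋₊ ≤ τ ∧ τ < ⌊(n : ℝ) * re⌋₊ ∧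
      cv n < svadfDelta (X n) τ ω}) (η + η + η + η) := by
  obtain ⟨κ', hκ', hs⟩ := sball hP h hv hVr hA (r := r0 / 2) (η := η)
    ⟨by linarith, by linarith⟩ hη
  obtain ⟨κ, hκ, rfl⟩ : ∃ κ, 0 < κ ∧ κ' = 4 * κ := ⟨κ' / 4, by positivity, by ring⟩
  obtain ⟨K, hK, hmax, -⟩ := maxb hP h hv hη
  obtain ⟨θ, hθ, hθ1, hθ2⟩ : ∃ θ : ℝ, 0 < θ ∧ θ < κ ^ 2 * η ∧ θ ≤ r0 / 2 := by
    have : 0 < κ ^ 2 * η := by positivity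
    exact ⟨min (κ ^ 2 * η / 2) (r0 / 2), by positivity,
      (min_le_left _ _).trans_lt (by linarith), min_le_right _ _⟩
  have ho1 := osc hP h hv (fun n => ⌊(n : ℝ) * 0⌋₊) (fun n => ⌊(n : ℝ) * θ⌋₊)
    (fun n => floor_mul_mono n hθ.le) hκ hη
    (Vdiff hv hVr le_rfl hθ.le (by linarith) (by linarith))
  have ho2 := osc hP h hv (fun n => ⌊(n : ℝ) * (r0 / 2)⌋₊) (fun n => ⌊(n : ℝ) * (r0 / 2 + θ)⌋₊)
    (fun n => floor_mul_mono n (by linarith)) hκ hη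
    (Vdiff hv hVr (by linarith) (by linarith) (by linarith) (by linarith))
  refine (((hs.union hmax hη.le hη.le).union ho1 (by positivity) hη.le).union ho2 (by positivity)
    hη.le).mono ?_
  filter_upwards [hv, floor_gap le_rfl hθ, hcv.eventually_ge_atTop (2 * (3 / 2 * K ^ 2 / κ ^ 2) / θ),
    eventually_gt_atTop 0] with n hv hgap hcv hn
  rintro ω ⟨τ, h1, h2, h3⟩
  by_contra hcon
  simp only [Set.mem_union, Set.mem_ofPred_eq, not_or, not_exists, not_and, not_le] at hcon
  obtain ⟨⟨⟨c1, c2⟩, c3⟩, c4⟩ := hcon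
  have hS : 0 < √(Vn P s n n) := Real.sqrt_pos.2 hv
  have hn' : (0 : ℝ) < n := by exact_mod_cast hn
  simp only [mul_zero, Nat.floor_zero, Nat.cast_zero, sub_zero] at hgap c3
  have hl : (0 : ℝ) < ⌊(n : ℝ) * θ⌋₊ := lt_of_lt_of_le (by positivity) hgap
  have hbl : ⌊(n : ℝ) * (r0 / 2)⌋₊ + ⌊(n : ℝ) * θ⌋₊ ≤ ⌊(n : ℝ) * (r0 / 2 + θ)⌋₊ := by
    apply Nat.le_floor
    push_cast
    rw [mul_add]
    exact add_le_add (Nat.floor_le (by positivity)) (Nat.floor_le (by positivity))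
  have hbl2 := floor_mul_mono n (show r0 / 2 + θ ≤ r0 by linarith)
  have hτn : τ ≤ n := h2.le.trans (floor_mul_le n hre)
  have hd := D1 (X n) ω (τ := τ) (b := ⌊(n : ℝ) * (r0 / 2)⌋₊) (l := ⌊(n : ℝ) * θ⌋₊) (K := K) (κ := κ)
    (S := √(Vn P s n n)) (by linarith) hκ hS (by exact_mod_cast hl) (by omega)
    (fun j => pS (s n) (e n) j ω) (fun j hj => hX n j (by omega) ω)
    (fun j hj => (c2 j (by omega)).le) c1.le
    (fun j hj => by
      have := c3 j (Nat.zero_le _) (by omega)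
      simpa [pS] using this.le)
    (fun j hj1 hj2 => (c4 j hj1 (by omega)).le)
  have : (τ : ℝ) * (3 / 2 * K ^ 2 / (⌊(n : ℝ) * θ⌋₊ * κ ^ 2)) ≤ 2 * (3 / 2 * K ^ 2 / κ ^ 2) / θ := by
    have e1 : (τ : ℝ) * (3 / 2 * K ^ 2 / (⌊(n : ℝ) * θ⌋₊ * κ ^ 2)) =
      (3 / 2 * K ^ 2 / κ ^ 2) * (τ / ⌊(n : ℝ) * θ⌋₊) := by field_simp
    have e2 : (τ : ℝ) / ⌊(n : ℝ) * θ⌋₊ ≤ 2 / θ := by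
      rw [div_le_div_iff₀ hl hθ]
      have : (τ : ℝ) ≤ n := by exact_mod_cast hτn
      nlinarith
    have e3 : 2 * (3 / 2 * K ^ 2 / κ ^ 2) / θ = (3 / 2 * K ^ 2 / κ ^ 2) * (2 / θ) := by ring
    rw [e1, e3]
    gcongr
  linarith

end Gsec


theorem path1 (x u : ℕ → ℝ) (E N : ℕ) (φ : ℝ)
    (hrec : ∀ j < E + N, x (j + 1) = x j + (if E ≤ j + 1 then φ else 0) * x j + u j) :
    ∀ j < E, x j = x 0 + ∑ t ∈ Finset.range j, u t := by
  intro j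
  induction j with
  | zero => simp
  | succ j ih =>
    intro hj
    rw [hrec j (by omega), if_neg (by omega), Finset.sum_range_succ, ih (by omega)]
    ring

theorem path2 (x u : ℕ → ℝ) (E N : ℕ) (φ : ℝ) (hE : 0 < E) (hφ : 0 < φ)
    (hrec : ∀ j < E + N, x (j + 1) = x j + (if E ≤ j + 1 then φ else 0) * x j + u j) :
    ∀ i, i ≤ N + 1 → x (E - 1 + i) = (1 + φ) ^ i * (x 0 + ∑ t ∈ Finset.range (E - 1), u t +
      ∑ t ∈ Finset.range (E - 1 + i), (if E ≤ t + 1 then ((1 + φ) ^ (t + 2 - E))⁻¹ else 0) * u t) := by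
  intro i
  induction i with
  | zero =>
    intro _
    rw [add_zero, path1 x u E N φ hrec (E - 1) (by omega), Finset.sum_eq_zero (f := fun t =>
      (if E ≤ t + 1 then ((1 + φ) ^ (t + 2 - E))⁻¹ else 0) * u t)]
    · ring
    · intro t ht
      rw [if_neg (by have := Finset.mem_range.1 ht; omega)]; ring
  | succ i ih =>
    intro hi
    have hd : (1 + φ) ≠ 0 := by positivity
    rw [← add_assoc, hrec (E - 1 + i) (by omega), if_pos (by omega), Finset.sum_range_succ,
      if_pos (by omega), ih (by omega), show E - 1 + i + 2 - E = i + 1 by omega]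
    field_simp
    ring

section Hsec
variable {Ω : Type*} [MeasurableSpace Ω] {P : ℕ → Measure Ω}
  {F : ℕ → ℕ → MeasurableSpace Ω} {s e : ℕ → ℕ → Ω → ℝ}

theorem inv_pow_small {φ : ℝ} (hφ : 0 < φ) (m : ℕ) : ((1 + φ) ^ m)⁻¹ ≤ (1 + m * φ)⁻¹ := by
  have := one_add_mul_le_pow (a := φ) (by linarith) m
  exact inv_anti₀ (by positivity) this

theorem Rbound (hP : ∀ n, IsProbabilityMeasure (P n)) (h : ∀ n, MD (P n) (F n) (s n) (e n))
    (hv : ∀ᶠ n in atTop, 0 < Vn P s n n)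
    (hVr : ∀ r ∈ Set.Icc (0 : ℝ) 1, Tendsto (fun n : ℕ => Vn P s n ⌊(n : ℝ) * r⌋₊ / Vn P s n n)
      atTop (nhds r)) {re : ℝ} (hre : 0 < re) (hre1 : re < 1)
    (φ : ℕ → ℝ) (hφ : ∀ᶠ n in atTop, 0 < φ n) (hy : Tendsto (fun n : ℕ => (n : ℝ) * φ n) atTop atTop)
    {κ η : ℝ} (hκ : 0 < κ) (hη : 0 < η) :
    Bd P (fun n => {ω | ∃ k ≤ n, κ * √(Vn P s n n) ≤
      |pS (fun t ω => (if ⌊(n : ℝ) * re⌋₊ ≤ t + 1 then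
        ((1 + φ n) ^ (t + 2 - ⌊(n : ℝ) * re⌋₊))⁻¹ else 0) * s n t ω) (e n) k ω|}) η := by
  set δ := κ ^ 2 * η / 2 with hδd
  have hδ : 0 < δ := by positivity
  obtain ⟨θ, hθ, hθ1, hθ2, hθ3⟩ : ∃ θ : ℝ, 0 < θ ∧ 2 * θ < δ ∧ θ < re ∧ re + θ ≤ 1 := by
    refine ⟨min (δ / 3) (min (re / 2) (1 - re)), ?_, ?_, ?_, ?_⟩
    · have : 0 < 1 - re := by linarith
      positivity
    · have := min_le_left (δ / 3) (min (re / 2) (1 - re)); linarith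
    · have := (min_le_right (δ / 3) (min (re / 2) (1 - re))).trans (min_le_left _ _); linarith
    · have := (min_le_right (δ / 3) (min (re / 2) (1 - re))).trans (min_le_right _ _); linarith
  refine wdoob hP h hv (fun n t => if ⌊(n : ℝ) * re⌋₊ ≤ t + 1 then
        ((1 + φ n) ^ (t + 2 - ⌊(n : ℝ) * re⌋₊))⁻¹ else 0) (fun n => n) hκ hη ?_
  filter_upwards [hv, Vdiff hv hVr (r1 := re - θ) (r2 := re + θ) (δ := δ) (by linarith) (by linarith)
    hθ3 (by linarith), hφ, floor_gap hre.le (show re < re + θ by linarith),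
    floor_gap (show 0 ≤ re - θ by linarith) (show re - θ < re by linarith),
    hy.eventually_ge_atTop (1 / δ / (θ / 2)), eventually_gt_atTop 0] with n hv hd hφ hg1 hg2 hy hn
  have hn' : (0 : ℝ) < n := by exact_mod_cast hn
  set E := ⌊(n : ℝ) * re⌋₊
  set G := ⌊(n : ℝ) * (re + θ)⌋₊ with hG
  set a := ⌊(n : ℝ) * (re - θ)⌋₊
  have haE : a + 1 ≤ E := by
    have : (0 : ℝ) < (E : ℝ) - a := lt_of_lt_of_le (by
      have : re - (re - θ) = θ := by ring
      rw [this]; positivity) hg2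
    have : (a : ℝ) < E := by linarith
    exact_mod_cast this
  have hGn : G ≤ n := floor_mul_le n hθ3
  have haG : a ≤ G := floor_mul_mono n (by linarith)
  have hEG : E ≤ G := floor_mul_mono n (by linarith)
  have hterm : ∀ t ∈ Finset.range n, (if E ≤ t + 1 then ((1 + φ n) ^ (t + 2 - E))⁻¹ else 0) ^ 2 *
      ∫ ω, (s n t ω) ^ 2 ∂(P n) ≤ (if t ∈ Finset.Ico a G then ∫ ω, (s n t ω) ^ 2 ∂(P n) else 0) +
        δ * ∫ ω, (s n t ω) ^ 2 ∂(P n) := by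
    intro t ht
    have hI : 0 ≤ ∫ ω, (s n t ω) ^ 2 ∂(P n) := integral_nonneg fun ω => sq_nonneg _
    by_cases h1 : E ≤ t + 1
    · rw [if_pos h1]
      have hw0 : 0 ≤ ((1 + φ n) ^ (t + 2 - E))⁻¹ := by positivity
      have hw1 : ((1 + φ n) ^ (t + 2 - E))⁻¹ ≤ 1 :=
        inv_le_one_of_one_le₀ (one_le_pow₀ (by linarith))
      by_cases h2 : t < G
      · rw [if_pos (Finset.mem_Ico.2 ⟨by omega, h2⟩)]
        nlinarith [pow_le_one₀ (n := 2) hw0 hw1, mul_nonneg hδ.le hI]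
      · rw [if_neg (by simp [h2]), zero_add]
        refine mul_le_mul_of_nonneg_right ?_ hI
        have h3 : ((1 + φ n) ^ (t + 2 - E))⁻¹ ≤ δ := by
          refine (inv_pow_small hφ _).trans ?_
          rw [inv_le_comm₀ (by positivity) hδ]
          have h4 : ((G : ℝ) - E) ≤ ((t + 2 - E : ℕ) : ℝ) := by
            have : G ≤ (t + 2 - E) + E := by omega
            have : (G : ℝ) ≤ ((t + 2 - E : ℕ) : ℝ) + E := by exact_mod_cast this
            linarith
          have h5 : (n : ℝ) * (θ / 2) ≤ ((t + 2 - E : ℕ) : ℝ) := by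
            have : re + θ - re = θ := by ring
            rw [this] at hg1
            linarith
          have h6 := mul_le_mul_of_nonneg_right h5 hφ.le
          rw [div_le_iff₀ (by positivity), one_div] at hy
          nlinarith
        nlinarith
    · rw [if_neg h1]
      have : 0 ≤ (if t ∈ Finset.Ico a G then ∫ ω, (s n t ω) ^ 2 ∂(P n) else 0) := by
        split_ifs
        · exact hI
        · exact le_rfl
      have := mul_nonneg hδ.le hI
      linarith
  refine (Finset.sum_le_sum hterm).trans ?_
  rw [Finset.sum_add_distrib, ← Finset.mul_sum, ← Finset.sum_filter]
  have hf : Finset.filter (fun t => t ∈ Finset.Ico a G) (Finset.range n) = Finset.Ico a G := by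
    ext t
    simp only [Finset.mem_filter, Finset.mem_range, Finset.mem_Ico]
    omega
  rw [hf, Finset.sum_Ico_eq_sub _ haG]
  change Vn P s n G - Vn P s n a + δ * Vn P s n n ≤ _
  have : κ ^ 2 * η = 2 * δ := by rw [hδd]; ring
  rw [this]
  linarith

end Hsec

section Isec
variable {Ω : Type*} [MeasurableSpace Ω] {P : ℕ → Measure Ω}
  {F : ℕ → ℕ → MeasurableSpace Ω} {s e : ℕ → ℕ → Ω → ℝ}

set_option maxHeartbeats 1000000 in
theorem part2 (hP : ∀ n, IsProbabilityMeasure (P n)) (h : ∀ n, MD (P n) (F n) (s n) (e n))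
    (hv : ∀ᶠ n in atTop, 0 < Vn P s n n)
    (hVr : ∀ r ∈ Set.Icc (0 : ℝ) 1, Tendsto (fun n : ℕ => Vn P s n ⌊(n : ℝ) * r⌋₊ / Vn P s n n)
      atTop (nhds r))
    (hA : ∀ r ∈ Set.Ioc (0 : ℝ) 1, ∀ δ : ℝ, 0 < δ → Tendsto (fun n : ℕ => P n {ω | δ ≤
      |pV (s n) ⌊(n : ℝ) * r⌋₊ ω / Vn P s n ⌊(n : ℝ) * r⌋₊ - 1|}) atTop (nhds 0))
    (X : ℕ → ℕ → Ω → ℝ) {re rf θ : ℝ} (hre : 0 < re) (hθ : 0 < θ) (hrf : re + θ ≤ rf) (hrf1 : rf < 1)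
    (φ : ℕ → ℝ) (hφ : ∀ᶠ n in atTop, 0 < φ n) (hφ0 : Tendsto φ atTop (nhds 0))
    (hy : Tendsto (fun n : ℕ => (n : ℝ) * φ n) atTop atTop)
    (hX : ∀ n j : ℕ, j < ⌊(n : ℝ) * rf⌋₊ → ∀ ω, X n (j + 1) ω = X n j ω +
      (if ⌊(n : ℝ) * re⌋₊ ≤ j + 1 then φ n else 0) * X n j ω + s n j ω * e n j ω)
    (hinit : ∀ δ : ℝ, 0 < δ → Tendsto (fun n : ℕ => P n {ω | δ ≤ |X n 0 ω / √(Vn P s n n)|})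
      atTop (nhds 0))
    (cv : ℕ → ℝ) (hcv : Tendsto (fun n : ℕ => cv n / (n * φ n)) atTop (nhds 0)) {η : ℝ} (hη : 0 < η) :
    Bd P (fun n => {ω | svadfDelta (X n) ⌊(n : ℝ) * (re + θ)⌋₊ ω ≤ cv n})
      (η + η + η + η + η + η) := by
  obtain ⟨κ', hκ', hs⟩ := sball hP h hv hVr hA (r := re) (η := η) ⟨hre, by linarith⟩ hη
  obtain ⟨κ, hκ, rfl⟩ : ∃ κ, 0 < κ ∧ κ' = 6 * κ := ⟨κ' / 6, by positivity, by ring⟩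
  obtain ⟨K1, hK1, hmax, hsq⟩ := maxb hP h hv hη
  obtain ⟨ζ, hζ, hζ1, hζ2⟩ : ∃ ζ : ℝ, 0 < ζ ∧ ζ < κ ^ 2 * η ∧ ζ < re := by
    have : 0 < κ ^ 2 * η := by positivity
    exact ⟨min (κ ^ 2 * η / 2) (re / 2), by positivity,
      (min_le_left _ _).trans_lt (by linarith), (min_le_right _ _).trans_lt (by linarith)⟩
  have ho := osc hP h hv (fun n => ⌊(n : ℝ) * (re - ζ)⌋₊) (fun n => ⌊(n : ℝ) * re⌋₊)
    (fun n => floor_mul_mono n (by linarith)) hκ hη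
    (Vdiff hv hVr (by linarith) (by linarith) (by linarith) (by linarith))
  have hR := Rbound hP h hv hVr hre (by linarith) φ hφ hy hκ hη
  have hI := Bd.of_tendsto hη (hinit κ hκ)
  set K := K1 + 2 * κ with hK
  have hKpos : 0 < K := by linarith
  refine (((((hs.union hmax hη.le hη.le).union hsq (by positivity) hη.le).union ho (by positivity)
    hη.le).union hR (by positivity) hη.le).union hI (by positivity) hη.le).mono ?_
  set C := θ / 2 * κ ^ 2 / (8 * K ^ 2) with hC
  have hCpos : 0 < C := by positivity
  filter_upwards [hv, hφ, floor_gap hre.le (show re < re + θ by linarith),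
    floor_gap (show 0 ≤ re - ζ by linarith) (show re - ζ < re by linarith),
    hcv.eventually (gt_mem_nhds hCpos),
    hφ0.eventually (gt_mem_nhds (show 0 < κ ^ 2 / (64 * K ^ 2) by positivity)),
    hy.eventually_ge_atTop (1 / (θ / 2) ^ 2),
    hy.eventually_ge_atTop (32 * K / κ / (θ / 2)),
    eventually_gt_atTop 0] with n hv hφ hg1 hg2 hcv hφs hy1 hy2 hn
  rw [show re + θ - re = θ by ring] at hg1
  rw [show re - (re - ζ) = ζ by ring] at hg2
  have hn' : (0 : ℝ) < n := by exact_mod_cast hn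
  intro ω hω
  by_contra hcon
  simp only [Set.mem_union, Set.mem_ofPred_eq, not_or, not_exists, not_and, not_le] at hcon hω
  obtain ⟨⟨⟨⟨⟨b1, b2⟩, b3⟩, b4⟩, b5⟩, b6⟩ := hcon
  have hτ1 := floor_mul_mono n hrf
  have hτ2 := floor_mul_le n hrf1.le
  have hEle : ⌊(n : ℝ) * re⌋₊ ≤ ⌊(n : ℝ) * (re + θ)⌋₊ := floor_mul_mono n (by linarith)
  obtain ⟨N, hN⟩ : ∃ N, ⌊(n : ℝ) * (re + θ)⌋₊ = ⌊(n : ℝ) * re⌋₊ + N := ⟨_, (Nat.add_sub_of_le hEle).symm⟩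
  rw [hN] at hω hg1 hτ1
  have haE : ⌊(n : ℝ) * (re - ζ)⌋₊ + 1 ≤ ⌊(n : ℝ) * re⌋₊ := by
    have : (0 : ℝ) < (⌊(n : ℝ) * re⌋₊ : ℝ) - ⌊(n : ℝ) * (re - ζ)⌋₊ := lt_of_lt_of_le (by positivity) hg2
    have : (⌊(n : ℝ) * (re - ζ)⌋₊ : ℝ) < ⌊(n : ℝ) * re⌋₊ := by linarith
    exact_mod_cast this
  set S := √(Vn P s n n) with hSd
  have hS : 0 < S := Real.sqrt_pos.2 hv
  have hS2 : S ^ 2 = Vn P s n n := Real.sq_sqrt hv.le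
  have hEn := floor_mul_le n (show re ≤ 1 by linarith)
  have hX' := hX n
  set E := ⌊(n : ℝ) * re⌋₊ with hE
  set f := φ n with hf
  have hgN : (n : ℝ) * (θ / 2) ≤ N := by push_cast at hg1; linarith
  have hyN : (n * f) * (θ / 2) ≤ f * N := by nlinarith
  have hpow : f * N ≤ (1 + f) ^ (N + 1) := by
    have := one_add_mul_le_pow (a := f) (by linarith) (N + 1)
    push_cast at this
    nlinarith
  have hrec : ∀ j < E + N, X n (j + 1) ω = X n j ω + (if E ≤ j + 1 then f else 0) * X n j ω +
      s n j ω * e n j ω := fun j hj => hX' j (by omega) ω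
  have hp1 := path1 (fun j => X n j ω) (fun j => s n j ω * e n j ω) E N f hrec
  have hp2 := path2 (fun j => X n j ω) (fun j => s n j ω * e n j ω) E N f (by omega) hφ hrec
  have hx0 : |X n 0 ω| ≤ κ * S := by
    rw [abs_div, abs_of_pos hS, div_lt_iff₀ hS] at b6
    exact b6.le
  have hRw : ∀ k, pS (fun t ω => (if E ≤ t + 1 then ((1 + f) ^ (t + 2 - E))⁻¹ else 0) * s n t ω)
      (e n) k ω = ∑ t ∈ Finset.range k, (if E ≤ t + 1 then ((1 + f) ^ (t + 2 - E))⁻¹ else 0) *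
        (s n t ω * e n t ω) := by
    intro k
    unfold pS
    exact Finset.sum_congr rfl fun t _ => by ring
  simp only [hRw] at b5
  have hd := D2 (X n) ω (E := E) (N := N) (φ := f) (K := K) (κ := κ) (S := S) (by omega) hφ hKpos hκ hS
    (fun j => s n j ω * e n j ω) hrec ?_ ?_ ?_ ?_ ?_ ?_ ?_
  · have e1 : C * (n * f) ≤ ((E + N : ℕ) : ℝ) * (f * κ ^ 2 / (8 * K ^ 2)) := by
      have : (n : ℝ) * (θ / 2) ≤ ((E + N : ℕ) : ℝ) := by
        push_cast
        have : (0 : ℝ) ≤ E := Nat.cast_nonneg _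
        linarith
      calc C * (n * f) = (n * (θ / 2)) * (f * κ ^ 2 / (8 * K ^ 2)) := by rw [hC]; ring
        _ ≤ _ := by gcongr
    rw [div_lt_iff₀ (by positivity)] at hcv
    linarith
  · intro j hj
    by_cases hjE : j < E - 1
    · rw [show j + 1 - E = 0 by omega, pow_zero, mul_one, hp1 j (by omega)]
      have := b2 j (by omega)
      unfold pS at this
      refine (abs_add_le _ _).trans ?_
      have hKS : K * S = K1 * S + 2 * (κ * S) := by rw [hK]; ring
      have hκS : 0 < κ * S := by positivity
      linarith
    · obtain ⟨i, rfl⟩ : ∃ i, j = E - 1 + i := ⟨j - (E - 1), by omega⟩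
      rw [show E - 1 + i + 1 - E = i by omega, hp2 i (by omega), abs_mul,
        abs_of_pos (by positivity : (0 : ℝ) < (1 + f) ^ i), mul_comm]
      refine mul_le_mul_of_nonneg_right ?_ (by positivity)
      have q1 := b2 (E - 1) (by omega)
      unfold pS at q1
      have q2 := b5 (E - 1 + i) (by omega)
      refine (abs_add_le _ _).trans ((add_le_add_left (abs_add_le _ _) _).trans ?_)
      have hKS : K * S = K1 * S + 2 * (κ * S) := by rw [hK]; ring
      have hκS : 0 < κ * S := by positivity
      linarith
  · rw [show E + N = E - 1 + (N + 1) by omega, hp2 (N + 1) le_rfl, abs_mul,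
        abs_of_pos (by positivity : (0 : ℝ) < (1 + f) ^ (N + 1)), mul_comm]
    refine mul_le_mul_of_nonneg_left ?_ (by positivity)
    have q2 := b5 (E - 1 + (N + 1)) (by omega)
    have q3 := b4 E (by omega) le_rfl
    have q4 := b4 (E - 1) (by omega) (by omega)
    change _ ≤ |X n 0 ω + pS (s n) (e n) (E - 1) ω + _|
    set R := ∑ t ∈ Finset.range (E - 1 + (N + 1)), (if E ≤ t + 1 then ((1 + f) ^ (t + 2 - E))⁻¹ else 0) *
        (s n t ω * e n t ω)
    have hκS : 0 < κ * S := by positivity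
    rw [abs_lt] at q2 q3 q4
    rw [abs_le] at hx0
    obtain ⟨q2, q2'⟩ := q2
    obtain ⟨q3, q3'⟩ := q3
    obtain ⟨q4, q4'⟩ := q4
    obtain ⟨q5, q5'⟩ := hx0
    rcases lt_abs.1 b1 with b1 | b1
    · exact le_trans (by linarith) (le_abs_self _)
    · exact le_trans (by linarith) (neg_le_abs _)
  · have : ∑ j ∈ Finset.range (E + N), (s n j ω * e n j ω) ^ 2 ≤
        ∑ j ∈ Finset.range n, (s n j ω * e n j ω) ^ 2 :=
      Finset.sum_le_sum_of_subset_of_nonneg (Finset.range_mono (by omega)) fun _ _ _ => sq_nonneg _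
    rw [hS2]
    have : K1 ^ 2 * Vn P s n n ≤ K ^ 2 * Vn P s n n := by
      gcongr
      linarith
    linarith
  · rw [div_le_iff₀ (by positivity)] at hy1
    have h1 : (E : ℝ) * f ≤ n * f := by
      have : (E : ℝ) ≤ n := by exact_mod_cast hEn
      gcongr
    have h2 : 0 ≤ (n * f) * (θ / 2) := by positivity
    have h3 : ((n * f) * (θ / 2)) ^ 2 ≤ ((1 + f) ^ (N + 1)) ^ 2 := pow_le_pow_left₀ h2 (hyN.trans hpow) 2
    have h4 : 0 < (n : ℝ) * f := by positivity
    nlinarith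
  · rw [div_le_iff₀ (by positivity), div_le_iff₀ (by positivity)] at hy2
    have := mul_le_mul_of_nonneg_left (hyN.trans hpow) hκ.le
    linarith
  · rw [div_le_iff₀ (by positivity), div_le_iff₀ (by positivity)] at hy2
    have := mul_le_mul_of_nonneg_left hyN hκ.le
    have h2 : 0 ≤ κ * (f * E) := by positivity
    push_cast
    linarith
  · rw [lt_div_iff₀ (by positivity)] at hφs
    linarith

end Isec

/-- Theorem 3, part 1 (consistent origination dating, coefficient statistic): in the
bubble model, under Assumptions A1, A2 and the initial-value condition, if the positive
thresholds satisfy `1/cv_n + cv_n/n^{1-α} → 0`, then the estimated origination fraction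
`r̂_e` based on `SV-ADF^δ` converges in probability to `r_e`. -/
theorem stmt2
    {Ω : Type*} [MeasurableSpace Ω]
    (P : ℕ → Measure Ω) (hP : ∀ n, IsProbabilityMeasure (P n))
    (ℱ : ℕ → ℕ → MeasurableSpace Ω) (hℱmono : ∀ n, Monotone (ℱ n))
    (hℱle : ∀ n t, ℱ n t ≤ ‹MeasurableSpace Ω›)
    (X σ ε : ℕ → ℕ → Ω → ℝ)
    (hX0meas : ∀ n, Measurable[ℱ n 0] (X n 0))
    (hσpos : ∀ n t, 1 ≤ t → t ≤ n → ∀ ω, 0 < σ n t ω)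
    (hσmeas : ∀ n t, 1 ≤ t → t ≤ n → Measurable[ℱ n (t - 1)] (σ n t))
    (hσint : ∀ n t, 1 ≤ t → t ≤ n → Integrable (fun ω => (σ n t ω) ^ 2) (P n))
    (hεmeas : ∀ n t, Measurable (ε n t))
    (hεgauss : ∀ n t, 1 ≤ t → t ≤ n → Measure.map (ε n t) (P n) = gaussianReal 0 1)
    (hεindep : ∀ n t, 1 ≤ t → t ≤ n →
      Indep (MeasurableSpace.comap (ε n t) inferInstance) (ℱ n (t - 1)) (P n))
    (huadapted : ∀ n t, 1 ≤ t → t ≤ n →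
      Measurable[ℱ n t] (fun ω => σ n t ω * ε n t ω))
    -- bubble model parameters
    (r0 re rf c α : ℝ)
    (hr0 : 0 < r0) (hr0e : r0 < re) (href : re < rf) (hrf1 : rf < 1)
    (hc : 0 < c) (hα : α ∈ Set.Ioo (0 : ℝ) 1)
    -- model equations
    (hmodel : ∀ n t, 1 ≤ t → t ≤ n → ∀ ω,
      X n t ω = (if ⌊(n : ℝ) * re⌋₊ ≤ t ∧ t ≤ ⌊(n : ℝ) * rf⌋₊
          then 1 + c * (n : ℝ) ^ (-α) else 1) * X n (t - 1) ω + σ n t ω * ε n t ω)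
    -- Assumption A1
    (hA1 : ∀ r ∈ Set.Ioc (0 : ℝ) 1, ∀ εp : ℝ, 0 < εp →
      Tendsto (fun n : ℕ => P n {ω |
          εp ≤ |(∑ t ∈ Finset.Icc 1 ⌊(n : ℝ) * r⌋₊, (σ n t ω) ^ 2) /
            ((⌊(n : ℝ) * r⌋₊ : ℝ) * avgVar P σ n ⌊(n : ℝ) * r⌋₊) - 1|})
        atTop (nhds 0))
    -- Assumption A2
    (hA2 : ∃ ζ ∈ Set.Ioo (0 : ℝ) 1, ∃ g : ℕ → ℝ,
      g =o[atTop] (fun n : ℕ => (n : ℝ) ^ (-(1 : ℝ) / 2)) ∧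
      ∀ n t : ℕ, (n : ℝ) ^ ζ < (t : ℝ) → t ≤ n →
        |avgVar P σ n t / avgVar P σ n n - 1| ≤ g n)
    -- initial-value condition
    (hinit : ∀ εp : ℝ, 0 < εp →
      Tendsto (fun n : ℕ => P n {ω |
          εp ≤ |X n 0 ω / Real.sqrt ((n : ℝ) * avgVar P σ n n)|})
        atTop (nhds 0))
    -- thresholds
    (cv : ℕ → ℝ) (hcvpos : ∀ n, 0 < cv n)
    (hcv : Tendsto (fun n : ℕ => 1 / cv n + cv n / (n : ℝ) ^ (1 - α))
      atTop (nhds 0)) :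
    ∀ εp : ℝ, 0 < εp →
      Tendsto (fun n : ℕ => P n {ω |
          εp ≤ |rHatE (fun τ => svadfDelta (X n) τ) n r0 (cv n) ω - re|})
        atTop (nhds 0) := by
  have hα0 := hα.1
  have hα1 := hα.2
  set s : ℕ → ℕ → Ω → ℝ := fun n t ω => if t < n then σ n (t + 1) ω else 0 with hs
  set e : ℕ → ℕ → Ω → ℝ := fun n t => ε n (t + 1) with he
  have hs1 : ∀ n t, t < n → s n t = σ n (t + 1) := by
    intro n t ht; funext ω; simp [hs, ht]
  have hs0 : ∀ n t, ¬ t < n → s n t = fun _ => 0 := by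
    intro n t ht; funext ω; simp [hs, ht]
  have hMD : ∀ n, MD (P n) (ℱ n) (s n) (e n) := by
    intro n
    refine ⟨hℱmono n, hℱle n, ?_, ?_, fun t => hεmeas n (t + 1), ?_, ?_⟩
    · intro t
      by_cases ht : t < n
      · rw [hs1 n t ht]; exact hσmeas n (t + 1) (by omega) (by omega)
      · rw [hs0 n t ht]; exact measurable_const
    · intro t
      by_cases ht : t < n
      · rw [hs1 n t ht]; exact huadapted n (t + 1) (by omega) (by omega)
      · rw [hs0 n t ht]; simp only [zero_mul]; exact measurable_const
    · intro t
      by_cases ht : t < n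
      · rw [hs1 n t ht]; exact hσint n (t + 1) (by omega) (by omega)
      · rw [hs0 n t ht]; simp
    · intro t
      by_cases ht : t < n
      · right
        exact ⟨hεgauss n (t + 1) (by omega) (by omega), hεindep n (t + 1) (by omega) (by omega)⟩
      · left
        intro ω
        rw [hs0 n t ht]
  have hVk : ∀ n k, k ≤ n → Vn P s n k = ∑ t ∈ Finset.Icc 1 k, ∫ ω, (σ n t ω) ^ 2 ∂(P n) := by
    intro n k hk
    rw [sum_Icc_shift]
    unfold Vn
    refine Finset.sum_congr rfl fun t ht => ?_
    rw [hs1 n t (by have := Finset.mem_range.1 ht; omega)]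
  have hVa : ∀ n k : ℕ, k ≤ n → (k : ℝ) * avgVar P σ n k = Vn P s n k := by
    intro n k hk
    rw [hVk n k hk]
    unfold avgVar
    rcases Nat.eq_zero_or_pos k with rfl | hk0
    · simp
    · have : (k : ℝ) ≠ 0 := by positivity
      field_simp
  have hvpos : ∀ n, 0 < n → 0 < Vn P s n n := by
    intro n hn
    rw [hVk n n le_rfl]
    have := hP n
    refine Finset.sum_pos (fun t ht => ?_) ⟨1, Finset.mem_Icc.2 ⟨le_rfl, hn⟩⟩
    obtain ⟨h1, h2⟩ := Finset.mem_Icc.1 ht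
    rw [integral_pos_iff_support_of_nonneg (fun ω => sq_nonneg _) (hσint n t h1 h2)]
    have : Function.support (fun ω => (σ n t ω) ^ 2) = Set.univ := by
      ext ω
      have := hσpos n t h1 h2 ω
      simp [this.ne']
    rw [this]
    simp
  have hv : ∀ᶠ n in atTop, 0 < Vn P s n n := by
    filter_upwards [eventually_gt_atTop 0] with n hn using hvpos n hn
  have hfl : ∀ r : ℝ, 0 ≤ r → Tendsto (fun n : ℕ => (⌊(n : ℝ) * r⌋₊ : ℝ) / n) atTop (nhds r) := by
    intro r hr
    have := (tendsto_nat_floor_mul_div_atTop hr).comp (tendsto_natCast_atTop_atTop (R := ℝ))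
    refine this.congr fun n => ?_
    simp only [Function.comp_apply, mul_comm]
  have hVr : ∀ r ∈ Set.Icc (0 : ℝ) 1,
      Tendsto (fun n : ℕ => Vn P s n ⌊(n : ℝ) * r⌋₊ / Vn P s n n) atTop (nhds r) := by
    rintro r ⟨h0, h1⟩
    rcases h0.eq_or_lt with rfl | h0
    · simp [Vn]
    obtain ⟨ζ, hζ, g, hg, hA2⟩ := hA2
    have hg0 : Tendsto g atTop (nhds 0) := by
      refine hg.trans_tendsto ?_
      have := (tendsto_rpow_neg_atTop (show (0 : ℝ) < 1 / 2 by norm_num)).comp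
        (tendsto_natCast_atTop_atTop (R := ℝ))
      refine this.congr fun n => ?_
      simp only [Function.comp_apply]
      norm_num
    have hz : Tendsto (fun n : ℕ => (n : ℝ) ^ ζ / n) atTop (nhds 0) := by
      have := (tendsto_rpow_neg_atTop (show (0 : ℝ) < 1 - ζ by linarith [hζ.2])).comp
        (tendsto_natCast_atTop_atTop (R := ℝ))
      refine this.congr' ?_
      filter_upwards [eventually_gt_atTop 0] with n hn
      have hn' : (0 : ℝ) < n := by exact_mod_cast hn
      simp only [Function.comp_apply]
      rw [show -(1 - ζ) = ζ - 1 by ring, Real.rpow_sub_one hn'.ne']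
    have hbig : ∀ᶠ n : ℕ in atTop, (n : ℝ) ^ ζ < (⌊(n : ℝ) * r⌋₊ : ℝ) := by
      filter_upwards [hz.eventually (gt_mem_nhds (show (0 : ℝ) < r / 2 by linarith)),
        (hfl r h0.le).eventually (lt_mem_nhds (show r / 2 < r by linarith)),
        eventually_gt_atTop 0] with n h1 h2 hn
      have hn' : (0 : ℝ) < n := by exact_mod_cast hn
      exact (div_lt_div_iff_of_pos_right hn').1 (h1.trans h2)
    have hrat : Tendsto (fun n : ℕ => avgVar P σ n ⌊(n : ℝ) * r⌋₊ / avgVar P σ n n - 1) atTop (nhds 0) := by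
      refine squeeze_zero_norm' ?_ hg0
      filter_upwards [hbig] with n hn
      exact hA2 n _ hn (floor_mul_le n h1)
    have hrat' := (hrat.add_const 1).mul (hfl r h0.le)
    simp only [sub_add_cancel, zero_add, one_mul] at hrat'
    refine hrat'.congr' ?_
    filter_upwards with n
    rw [← hVa n _ (floor_mul_le n h1), ← hVa n n le_rfl]
    rw [div_mul_div_comm, mul_comm, mul_comm (avgVar P σ n n)]
  have hA : ∀ r ∈ Set.Ioc (0 : ℝ) 1, ∀ δ : ℝ, 0 < δ → Tendsto (fun n : ℕ => P n {ω | δ ≤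
      |pV (s n) ⌊(n : ℝ) * r⌋₊ ω / Vn P s n ⌊(n : ℝ) * r⌋₊ - 1|}) atTop (nhds 0) := by
    intro r hr δ hδ
    refine (hA1 r hr δ hδ).congr fun n => ?_
    have hk := floor_mul_le n hr.2
    have : ∀ ω, ∑ t ∈ Finset.Icc 1 ⌊(n : ℝ) * r⌋₊, (σ n t ω) ^ 2 = pV (s n) ⌊(n : ℝ) * r⌋₊ ω := by
      intro ω
      rw [sum_Icc_shift]
      unfold pV
      refine Finset.sum_congr rfl fun t ht => ?_
      rw [hs1 n t (by have := Finset.mem_range.1 ht; omega)]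
    simp only [this, hVa n _ hk]
  set φ : ℕ → ℝ := fun n => c * (n : ℝ) ^ (-α) with hφd
  have hφ : ∀ᶠ n in atTop, 0 < φ n := by
    filter_upwards [eventually_gt_atTop 0] with n hn
    have hn' : (0 : ℝ) < n := by exact_mod_cast hn
    have := Real.rpow_pos_of_pos hn' (-α)
    exact mul_pos hc this
  have hφ0 : Tendsto φ atTop (nhds 0) := by
    have := ((tendsto_rpow_neg_atTop hα0).comp (tendsto_natCast_atTop_atTop (R := ℝ))).const_mul c
    rw [mul_zero] at this
    exact this
  have hyeq : ∀ᶠ n : ℕ in atTop, c * (n : ℝ) ^ (1 - α) = n * φ n := by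
    filter_upwards [eventually_gt_atTop 0] with n hn
    have hn' : (0 : ℝ) < n := by exact_mod_cast hn
    simp only [hφd]
    rw [show 1 - α = 1 + -α by ring, Real.rpow_add hn', Real.rpow_one]
    ring
  have hy : Tendsto (fun n : ℕ => (n : ℝ) * φ n) atTop atTop := by
    have := ((tendsto_rpow_atTop (show 0 < 1 - α by linarith)).comp
      (tendsto_natCast_atTop_atTop (R := ℝ))).const_mul_atTop hc
    exact this.congr' hyeq
  have hrpn : ∀ n : ℕ, 0 ≤ (n : ℝ) ^ (1 - α) := fun n => by positivity
  have hcv1 : Tendsto (fun n : ℕ => 1 / cv n) atTop (nhds 0) := by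
    refine squeeze_zero (fun n => by have := hcvpos n; positivity) (fun n => ?_) hcv
    have := div_nonneg (hcvpos n).le (hrpn n)
    linarith
  have hcv2 : Tendsto (fun n : ℕ => cv n / (n : ℝ) ^ (1 - α)) atTop (nhds 0) := by
    refine squeeze_zero (fun n => div_nonneg (hcvpos n).le (hrpn n)) (fun n => ?_) hcv
    have := div_nonneg zero_le_one (hcvpos n).le
    linarith
  have hcvT : Tendsto cv atTop atTop := by
    have h1 : Tendsto (fun n : ℕ => 1 / cv n) atTop (nhdsWithin 0 (Set.Ioi 0)) :=
      tendsto_nhdsWithin_iff.2 ⟨hcv1, Eventually.of_forall fun n => by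
        have := hcvpos n
        simp [this]⟩
    have := h1.inv_tendsto_nhdsGT_zero
    refine this.congr fun n => ?_
    simp
  have hcvφ : Tendsto (fun n : ℕ => cv n / (n * φ n)) atTop (nhds 0) := by
    have := hcv2.const_mul (1 / c)
    rw [mul_zero] at this
    refine this.congr' ?_
    filter_upwards [hyeq] with n hn
    rw [← hn]
    rw [div_mul_div_comm, one_mul]
  have hX : ∀ n j : ℕ, j < ⌊(n : ℝ) * rf⌋₊ → ∀ ω, X n (j + 1) ω = X n j ω +
      (if ⌊(n : ℝ) * re⌋₊ ≤ j + 1 then φ n else 0) * X n j ω + s n j ω * e n j ω := by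
    intro n j hj ω
    have hn := floor_mul_le n hrf1.le
    rw [hmodel n (j + 1) (by omega) (by omega) ω, hs1 n j (by omega)]
    simp only [he, hφd, Nat.add_sub_cancel]
    by_cases hE : ⌊(n : ℝ) * re⌋₊ ≤ j + 1
    · rw [if_pos ⟨hE, by omega⟩, if_pos hE]; ring
    · rw [if_neg (fun h => hE h.1), if_neg hE]; ring
  have hX1 : ∀ n j : ℕ, j < ⌊(n : ℝ) * re⌋₊ → ∀ ω, X n j ω = X n 0 ω + pS (s n) (e n) j ω := by
    intro n j hj ω
    have hle := floor_mul_mono n href.le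
    exact path1 (fun j => X n j ω) (fun j => s n j ω * e n j ω) ⌊(n : ℝ) * re⌋₊ 0 (φ n)
      (fun i hi => hX n i (by omega) ω) j hj
  have hinit' : ∀ δ : ℝ, 0 < δ → Tendsto (fun n : ℕ => P n {ω | δ ≤ |X n 0 ω / √(Vn P s n n)|})
      atTop (nhds 0) := by
    intro δ hδ
    refine (hinit δ hδ).congr fun n => ?_
    rw [hVa n n le_rfl]
  intro εp hεp
  obtain ⟨θ, hθ, hθ1, hθ2⟩ : ∃ θ : ℝ, 0 < θ ∧ θ < εp ∧ re + θ ≤ rf := by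
    have : 0 < rf - re := by linarith
    refine ⟨min (εp / 2) (rf - re), by positivity, (min_le_left _ _).trans_lt (by linarith), ?_⟩
    have := min_le_right (εp / 2) (rf - re)
    linarith
  rw [ENNReal.tendsto_nhds_zero]
  intro ε0 hε0
  obtain ⟨η0, hη0, hη0'⟩ := ENNReal.lt_iff_exists_nnreal_btwn.1 hε0
  have hη0r : (0 : ℝ) < η0 := by exact_mod_cast hη0
  obtain ⟨η, hη, hη10⟩ : ∃ η : ℝ, 0 < η ∧ (η0 : ℝ) = (η + η + η + η) + (η + η + η + η + η + η) :=
    ⟨η0 / 10, by positivity, by ring⟩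
  have hp1 := part1 hP hMD hv hVr hA X hr0 (by linarith) hr0e hX1 cv hcvT hη
  have hp2 := part2 hP hMD hv hVr hA X (by linarith) hθ hθ2 hrf1 φ hφ hφ0 hy hX hinit' cv hcvφ hη
  have hu := hp1.union hp2 (by positivity) (by positivity)
  rw [← hη10] at hu
  have hfin : Bd P (fun n => {ω | εp ≤ |rHatE (fun τ => svadfDelta (X n) τ) n r0 (cv n) ω - re|})
      (η0 : ℝ) := by
    refine hu.mono ?_
    filter_upwards [floor_gap (show 0 ≤ re - min θ (re - r0) by
        have := min_le_right θ (re - r0); linarith)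
        (show re - min θ (re - r0) < re by
          have : 0 < min θ (re - r0) := lt_min hθ (by linarith)
          linarith), eventually_gt_atTop 0] with n hgap hn
    intro ω hω
    by_contra hcon
    simp only [Set.mem_union, Set.mem_ofPred_eq, not_or, not_exists, not_and, not_le, not_lt] at hcon hω
    obtain ⟨g1, g2⟩ := hcon
    have hn' : (0 : ℝ) < n := by exact_mod_cast hn
    have hmpos : 0 < min θ (re - r0) := lt_min hθ (by linarith)
    set a := min θ (re - r0)
    have ha1 : a ≤ θ := min_le_left _ _
    have hup : rHatE (fun τ => svadfDelta (X n) τ) n r0 (cv n) ω ≤ re + θ := by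
      unfold rHatE
      refine csInf_le ⟨r0, ?_⟩ (Or.inl ⟨⟨by linarith, by linarith⟩, g2⟩)
      rintro x (hx | hx)
      · exact hx.1.1
      · rw [Set.mem_singleton_iff.1 hx]; linarith
    have hlo : re - a ≤ rHatE (fun τ => svadfDelta (X n) τ) n r0 (cv n) ω := by
      unfold rHatE
      refine le_csInf ⟨1, Or.inr rfl⟩ ?_
      rintro x (hx | hx)
      · by_contra hlt
        push Not at hlt
        have e1 := floor_mul_mono n hx.1.1
        have e2 := floor_mul_mono n hlt.le
        have e3 : ⌊(n : ℝ) * (re - a)⌋₊ < ⌊(n : ℝ) * re⌋₊ := by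
          have : (0 : ℝ) < n * ((re - (re - a)) / 2) := by
            rw [show re - (re - a) = a by ring]; positivity
          have : (⌊(n : ℝ) * (re - a)⌋₊ : ℝ) < ⌊(n : ℝ) * re⌋₊ := by linarith
          exact_mod_cast this
        exact absurd hx.2 (not_lt.2 (g1 _ e1 (by omega)))
      · rw [Set.mem_singleton_iff.1 hx]; linarith
    have : |rHatE (fun τ => svadfDelta (X n) τ) n r0 (cv n) ω - re| ≤ θ := by
      rw [abs_le]; constructor <;> linarith
    linarith
  filter_upwards [hfin] with n hn
  refine hn.trans ?_
  rw [ENNReal.ofReal_coe_nnreal]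
  exact hη0'.le
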